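/- Under the standing hypotheses, no vertex of G lies simultaneously in a cycle of length g and in two distinct cycles of length g+1 in G. -/

import Mathlib

open SimpleGraph

/-- Two graphs have the same `k`-deck if there is a bijection between their `k`-element
vertex subsets under which corresponding induced subgraphs are isomorphic. -/
def SameDeck {V W : Type*} [Fintype V] [Fintype W] [DecidableEq V] [DecidableEq W]
    (G : SimpleGraph V) (H : SimpleGraph W) (k : ℕ) : Prop :=
  ∃ e : {s : Finset V // s.card = k} ≃ {s : Finset W // s.card = k},
    ∀ s : {s : Finset V // s.card = k},
      Nonempty ((G.induce (↑s.1 : Set V)) ≃g (H.induce (↑(e s).1 : Set W)))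

set_option linter.unusedSectionVars false
set_option linter.unusedDecidableInType false
set_option linter.unusedFintypeInType false

section SubsetExcess

variable {V : Type*} [DecidableEq V]

open Classical in
/-- The number of neighbours of `v` inside the finite set `S`. -/
noncomputable def degIn (Γ : SimpleGraph V) (S : Finset V) (v : V) : ℕ :=
  (S.filter (Γ.Adj v)).card

/-- The number of vertices minus the number of edges of the subgraph induced by `S`. -/
noncomputable def excess (Γ : SimpleGraph V) (S : Finset V) : ℤ :=
  S.card - ((∑ v ∈ S, degIn Γ S v) / 2 : ℕ)

/-- `S` induces a nonempty subgraph of minimum degree at least two. -/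
def IsCore (Γ : SimpleGraph V) (S : Finset V) : Prop :=
  S.Nonempty ∧ ∀ v ∈ S, 2 ≤ degIn Γ S v

variable {Γ Γ' : SimpleGraph V} {S T : Finset V} {u v : V}

open Classical in
lemma degIn_insert (hv : v ∉ S) :
    degIn Γ (insert v S) u = degIn Γ S u + if Γ.Adj u v then 1 else 0 := by
  unfold degIn
  rw [Finset.filter_insert]
  split_ifs with h
  · rw [Finset.card_insert_of_notMem (by simp [hv])]
  · simp

lemma degIn_insert_self : degIn Γ (insert v S) v = degIn Γ S v := by
  classical
  unfold degIn
  rw [Finset.filter_insert]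
  simp

lemma degIn_erase_self : degIn Γ (S.erase v) v = degIn Γ S v := by
  classical
  by_cases hv : v ∈ S
  · conv_rhs => rw [← Finset.insert_erase hv]
    rw [degIn_insert_self]
  · rw [Finset.erase_eq_of_notMem hv]

lemma degIn_mono (h : S ⊆ T) : degIn Γ S v ≤ degIn Γ T v := by
  classical
  exact Finset.card_le_card (Finset.filter_subset_filter _ h)

lemma degIn_union (h : Disjoint S T) : degIn Γ (S ∪ T) v = degIn Γ S v + degIn Γ T v := by
  classical
  unfold degIn
  rw [Finset.filter_union, Finset.card_union_of_disjoint]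
  exact Finset.disjoint_filter_filter h

lemma degIn_congr (h : ∀ u ∈ S, Γ.Adj v u ↔ Γ'.Adj v u) : degIn Γ S v = degIn Γ' S v := by
  classical
  unfold degIn
  rw [Finset.filter_congr h]

lemma one_le_degIn (hu : u ∈ S) (h : Γ.Adj v u) : 1 ≤ degIn Γ S v := by
  classical
  exact Finset.card_pos.2 ⟨u, by simp [hu, h]⟩

lemma degIn_pos_iff : 0 < degIn Γ S v ↔ ∃ u ∈ S, Γ.Adj v u := by
  classical
  unfold degIn
  rw [Finset.card_pos]
  simp [Finset.Nonempty]

lemma two_le_degIn {w : V} (hu : u ∈ S) (hw : w ∈ S) (huw : u ≠ w) (h : Γ.Adj v u)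
    (h' : Γ.Adj v w) : 2 ≤ degIn Γ S v := by
  classical
  have : ({u, w} : Finset V) ⊆ S.filter (Γ.Adj v) := by
    intro z; simp; rintro (rfl | rfl) <;> simp [*]
  rw [← Finset.card_pair huw]
  exact Finset.card_le_card this

lemma sum_degIn_insert (hv : v ∉ S) : ∑ u ∈ insert v S, degIn Γ (insert v S) u
    = ∑ u ∈ S, degIn Γ S u + 2 * degIn Γ S v := by
  classical
  rw [Finset.sum_insert hv, degIn_insert_self]
  simp_rw [degIn_insert hv]
  rw [Finset.sum_add_distrib]
  have : ∑ u ∈ S, (if Γ.Adj u v then 1 else 0) = degIn Γ S v := by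
    unfold degIn
    rw [Finset.card_filter]
    exact Finset.sum_congr rfl fun _ _ => by simp [Γ.adj_comm]
  omega

lemma even_sum_degIn (Γ : SimpleGraph V) (S : Finset V) : Even (∑ u ∈ S, degIn Γ S u) := by
  classical
  induction S using Finset.induction_on with
  | empty => simp
  | insert v S hv ih =>
    rw [sum_degIn_insert hv]
    exact ih.add (even_two_mul _)

lemma two_mul_excess (Γ : SimpleGraph V) (S : Finset V) :
    2 * excess Γ S = 2 * S.card - (∑ u ∈ S, degIn Γ S u : ℕ) := by
  obtain ⟨k, hk⟩ := even_sum_degIn Γ S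
  unfold excess
  rw [hk]
  omega

lemma excess_insert (hv : v ∉ S) : excess Γ (insert v S) = excess Γ S + 1 - degIn Γ S v := by
  have h1 := two_mul_excess Γ S
  have h2 := two_mul_excess Γ (insert v S)
  rw [sum_degIn_insert hv, Finset.card_insert_of_notMem hv] at h2
  push_cast at h1 h2
  omega

lemma excess_erase (hv : v ∈ S) : excess Γ (S.erase v) = excess Γ S - 1 + degIn Γ S v := by
  have h := excess_insert (Γ := Γ) (Finset.notMem_erase v S)
  rw [Finset.insert_erase hv, degIn_erase_self] at h
  omega

@[simp] lemma excess_empty : excess Γ ∅ = 0 := by simp [excess]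

lemma excess_singleton : excess Γ {v} = 1 := by
  have := excess_insert (Γ := Γ) (Finset.notMem_empty v)
  simpa [degIn] using this

lemma excess_union (h : Disjoint S T) :
    excess Γ (S ∪ T) = excess Γ S + excess Γ T - (∑ u ∈ S, degIn Γ T u : ℕ) := by
  classical
  induction S using Finset.induction_on with
  | empty => simp
  | insert v S hv ih =>
    rw [Finset.disjoint_insert_left] at h
    rw [Finset.insert_union, excess_insert (by simp [hv, h.1]), ih h.2, excess_insert hv,
      Finset.sum_insert hv, degIn_union h.2]
    push_cast
    ring

lemma excess_congr (h : ∀ u ∈ S, ∀ v ∈ S, Γ.Adj u v ↔ Γ'.Adj u v) :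
    excess Γ S = excess Γ' S := by
  unfold excess
  rw [Finset.sum_congr rfl fun u hu => degIn_congr (h u hu)]

lemma IsCore.excess_nonpos (h : IsCore Γ S) : excess Γ S ≤ 0 := by
  have h1 := two_mul_excess Γ S
  have h2 : ∑ u ∈ S, 2 ≤ ∑ u ∈ S, degIn Γ S u := Finset.sum_le_sum h.2
  simp at h2
  omega

lemma IsCore.congr (h : IsCore Γ S) (hc : ∀ u ∈ S, ∀ v ∈ S, Γ.Adj u v ↔ Γ'.Adj u v) :
    IsCore Γ' S :=
  ⟨h.1, fun v hv => by rw [← degIn_congr (hc v hv)]; exact h.2 v hv⟩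

/-- A nonempty set spanning at least as many edges as vertices contains a core. -/
lemma exists_isCore_of_excess_nonpos (hS : S.Nonempty) (h : excess Γ S ≤ 0) :
    ∃ T ⊆ S, IsCore Γ T := by
  classical
  induction S using Finset.strongInduction with
  | H S ih =>
    by_cases hc : ∀ v ∈ S, 2 ≤ degIn Γ S v
    · exact ⟨S, subset_rfl, hS, hc⟩
    · push Not at hc
      obtain ⟨v, hv, hd⟩ := hc
      have he := excess_erase (Γ := Γ) hv
      have hne : (S.erase v).Nonempty := by
        by_contra hn
        rw [Finset.not_nonempty_iff_eq_empty] at hn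
        have : S = {v} := by rw [← Finset.insert_erase hv, hn]; rfl
        rw [this, excess_singleton] at h
        omega
      obtain ⟨T, hT, hT'⟩ := ih _ (Finset.erase_ssubset hv) hne (by omega)
      exact ⟨T, hT.trans (Finset.erase_subset _ _), hT'⟩

/-- Adding two adjacent vertices, each with a neighbour in `S`, lowers the excess. -/
lemma excess_insert_insert_le (hu : u ∉ S) (hv : v ∉ S) (huv : Γ.Adj u v)
    (h1 : 1 ≤ degIn Γ S u) (h2 : 1 ≤ degIn Γ S v) :
    excess Γ (insert u (insert v S)) ≤ excess Γ S - 1 := by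
  classical
  rw [excess_insert (by simp [hu, huv.ne]), excess_insert hv, degIn_insert hv, if_pos huv]
  push_cast
  omega

lemma card_insert_insert (hu : u ∉ S) (hv : v ∉ S) (huv : u ≠ v) :
    (insert u (insert v S)).card = S.card + 2 := by
  rw [Finset.card_insert_of_notMem (by simp [hu, huv]), Finset.card_insert_of_notMem hv]

end SubsetExcess

section Switching

variable {V : Type*} [Fintype V] [DecidableEq V]

/-- The two graphs agree on all pairs avoiding `x` and `y`. -/
def AgreeOff (Γ Γ' : SimpleGraph V) (x y : V) : Prop :=
  ∀ u v, u ≠ x → u ≠ y → v ≠ x → v ≠ y → (Γ.Adj u v ↔ Γ'.Adj u v)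

/-- A class of cubic graphs on `V`, closed under relabelling, none of whose members is determined
up to isomorphism by the subgraph obtained by deleting two vertices. -/
structure IsAltFamily (K : SimpleGraph V → Prop) : Prop where
  comap : ∀ Γ, K Γ → ∀ e : Equiv.Perm V, K (Γ.comap e)
  reg : ∀ Γ, K Γ → ∀ v, degIn Γ Finset.univ v = 3
  alt : ∀ Γ, K Γ → ∀ x y, x ≠ y → ∃ Γ', K Γ' ∧ AgreeOff Γ Γ' x y ∧
    ∀ e : Equiv.Perm V, Γ' ≠ Γ.comap e

variable {K : SimpleGraph V → Prop} {Γ Γ' : SimpleGraph V} {x y : V}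

lemma AgreeOff.eq (h : AgreeOff Γ Γ' x y) (hx : ∀ v, Γ.Adj x v ↔ Γ'.Adj x v)
    (hy : ∀ v, Γ.Adj y v ↔ Γ'.Adj y v) : Γ = Γ' := by
  ext u v
  by_cases h1 : u = x
  · subst h1; exact hx v
  by_cases h2 : u = y
  · subst h2; exact hy v
  by_cases h3 : v = x
  · subst h3; rw [Γ.adj_comm, Γ'.adj_comm]; exact hx u
  by_cases h4 : v = y
  · subst h4; rw [Γ.adj_comm, Γ'.adj_comm]; exact hy u
  exact h u v h1 h2 h3 h4

lemma AgreeOff.symm (h : AgreeOff Γ Γ' x y) : AgreeOff Γ' Γ x y :=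
  fun u v h1 h2 h3 h4 => (h u v h1 h2 h3 h4).symm

lemma agreeOff_comap_swap (Γ : SimpleGraph V) (x y : V) :
    AgreeOff Γ (Γ.comap (Equiv.swap x y)) x y := by
  intro u v h1 h2 h3 h4
  simp [Equiv.swap_apply_of_ne_of_ne h1 h2, Equiv.swap_apply_of_ne_of_ne h3 h4]

lemma AgreeOff.comap_swap (h : AgreeOff Γ Γ' x y) :
    AgreeOff Γ (Γ'.comap (Equiv.swap x y)) x y := fun u v h1 h2 h3 h4 =>
  (h u v h1 h2 h3 h4).trans (agreeOff_comap_swap Γ' x y u v h1 h2 h3 h4)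

lemma AgreeOff.eq_comap_swap (h : AgreeOff Γ Γ' x y)
    (hx : ∀ v, Γ.Adj y (Equiv.swap x y v) ↔ Γ'.Adj x v)
    (hy : ∀ v, Γ.Adj x (Equiv.swap x y v) ↔ Γ'.Adj y v) : Γ.comap (Equiv.swap x y) = Γ' := by
  refine AgreeOff.eq (x := x) (y := y) ?_ (by simpa using hx) (by simpa using hy)
  exact (h.symm.comap_swap).symm

lemma AgreeOff.adj_and_or (hxy : x ≠ y) (hreg : ∀ v, degIn Γ Finset.univ v = 3)
    (hreg' : ∀ v, degIn Γ' Finset.univ v = 3) (h : AgreeOff Γ Γ' x y) :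
    (∀ v, v ≠ x → v ≠ y → (Γ'.Adj x v ∧ Γ'.Adj y v ↔ Γ.Adj x v ∧ Γ.Adj y v) ∧
      (Γ'.Adj x v ∨ Γ'.Adj y v ↔ Γ.Adj x v ∨ Γ.Adj y v)) ∧ (Γ'.Adj x y ↔ Γ.Adj x y) := by
  classical
  set S : Finset V := Finset.univ.filter fun v => v ≠ x ∧ v ≠ y with hS
  have hyS : y ∉ S := by simp [hS]
  have hxS : x ∉ insert y S := by simp [hS, hxy]
  have hxS' : x ∉ S := by simp [hS]
  have hu : (Finset.univ : Finset V) = insert x (insert y S) := by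
    ext v; simp [hS]; tauto
  have key : ∀ Δ : SimpleGraph V, (∀ v, degIn Δ Finset.univ v = 3) → ∀ v,
      degIn Δ S v + (if Δ.Adj v y then 1 else 0) + (if Δ.Adj v x then 1 else 0) = 3 := by
    intro Δ hΔ v
    have := hΔ v
    rwa [hu, degIn_insert hxS, degIn_insert hyS] at this
  have hdeg : ∀ v, v ≠ x → v ≠ y → degIn Γ S v = degIn Γ' S v := by
    intro v h1 h2
    refine degIn_congr fun u hu => ?_
    simp only [hS, Finset.mem_filter] at hu
    exact h v u h1 h2 hu.2.1 hu.2.2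
  have hsum : ∀ v, v ≠ x → v ≠ y →
      (if Γ.Adj v y then 1 else 0) + (if Γ.Adj v x then 1 else 0) =
      (if Γ'.Adj v y then 1 else 0) + (if Γ'.Adj v x then 1 else 0) := by
    intro v h1 h2
    have e1 := key Γ hreg v
    have e2 := key Γ' hreg' v
    have e3 := hdeg v h1 h2
    omega
  constructor
  · intro v h1 h2
    have := hsum v h1 h2
    rw [Γ.adj_comm v y, Γ.adj_comm v x, Γ'.adj_comm v y, Γ'.adj_comm v x] at this
    by_cases a1 : Γ.Adj y v <;> by_cases a2 : Γ.Adj x v <;> by_cases a3 : Γ'.Adj y v <;>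
      by_cases a4 : Γ'.Adj x v <;> revert this <;> simp [a1, a2, a3, a4]
  · have hd : ∀ Δ : SimpleGraph V, ∀ w, degIn Δ S w = ∑ v ∈ S, if Δ.Adj v w then 1 else 0 := by
      intro Δ w
      unfold degIn
      rw [Finset.card_filter]
      exact Finset.sum_congr rfl fun _ _ => by simp [Δ.adj_comm]
    have ht : degIn Γ S y + degIn Γ S x = degIn Γ' S y + degIn Γ' S x := by
      simp only [hd, ← Finset.sum_add_distrib]
      refine Finset.sum_congr rfl fun v hv => ?_
      simp only [hS, Finset.mem_filter] at hv
      exact hsum v hv.2.1 hv.2.2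
    have e1 := key Γ hreg x
    have e2 := key Γ' hreg' x
    have e3 := key Γ hreg y
    have e4 := key Γ' hreg' y
    simp only [SimpleGraph.irrefl, if_false] at e1 e2 e3 e4
    rw [Γ.adj_comm y x] at e3
    rw [Γ'.adj_comm y x] at e4
    by_cases b1 : Γ.Adj x y <;> by_cases b2 : Γ'.Adj x y <;>
      simp only [b1, b2, if_true, if_false, iff_self, iff_true, iff_false, not_true] at * <;> omega

/-- `z` and `z'` are the endpoints of corresponding edges at `x` and `y`: either `x` and `y` are
adjacent to each other, or they have the common neighbour `z`. -/
def IsLink (x y z z' : V) : Prop := (z = y ∧ z' = x) ∨ (z = z' ∧ z ≠ x ∧ z ≠ y)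

lemma degIn_univ_eq (S : Finset V) (h : ∀ v, Γ.Adj x v → v ∈ S) :
    degIn Γ Finset.univ x = degIn Γ S x := by
  classical
  unfold degIn
  congr 1
  ext v
  simp only [Finset.mem_filter, Finset.mem_univ, true_and]
  exact ⟨fun hv => ⟨h v hv, hv⟩, fun hv => hv.2⟩

lemma ne_of_forall_ne_comap (hne : ∀ e : Equiv.Perm V, Γ' ≠ Γ.comap e) : Γ ≠ Γ' := by
  rintro rfl
  exact hne 1 (by ext; simp)

lemma IsAltFamily.false_of_two_links (hK : IsAltFamily K) (hΓ : K Γ) (hxy : x ≠ y)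
    {z z' w a b : V} (hz : IsLink x y z z') (hwx : w ≠ x) (hwy : w ≠ y) (hwz : w ≠ z)
    (haz : a ≠ z) (haw : a ≠ w) (hay : a ≠ y) (hbz : b ≠ z) (hbw : b ≠ w) (hbx : b ≠ x)
    (hx : ∀ v, Γ.Adj x v ↔ v = z ∨ v = w ∨ v = a) (hy : ∀ v, Γ.Adj y v ↔ v = z' ∨ v = w ∨ v = b) :
    False := by
  classical
  obtain ⟨Γ', hΓ', hag, hne⟩ := hK.alt Γ hΓ x y hxy
  obtain ⟨hv, hadj⟩ := hag.adj_and_or hxy (hK.reg _ hΓ) (hK.reg _ hΓ')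
  have hax : a ≠ x := by rintro rfl; have := (hx a).2 (by simp); simp at this
  have hby : b ≠ y := by rintro rfl; have := (hy b).2 (by simp); simp at this
  have hΓyx := Γ'.adj_comm x y
  have hΓ0 := Γ.adj_comm x y
  have i1 := Γ.irrefl (v := x)
  have i2 := Γ.irrefl (v := y)
  have i1 := Γ'.irrefl (v := x)
  have i2 := Γ'.irrefl (v := y)
  have hsup : ∀ v, Γ'.Adj x v → v ∈ ({z, w, a, b} : Finset V) := by
    intro v h
    unfold IsLink at hz
    simp only [Finset.mem_insert, Finset.mem_singleton]
    have := hv v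
    by_cases e1 : v = x <;> by_cases e2 : v = y <;> grind
  have hdeg := hK.reg _ hΓ' x
  rw [degIn_univ_eq _ hsup] at hdeg
  have hwb := (hv w hwx hwy).1
  have ha := hv a hax hay
  have hb := hv b hbx hby
  have hxz : Γ'.Adj x z ∧ Γ'.Adj y z' := by
    unfold IsLink at hz
    have := hv z
    grind
  by_cases hab : a = b
  · subst hab
    refine ne_of_forall_ne_comap hne (hag.eq ?_ ?_) <;> intro v <;> unfold IsLink at hz <;>
      have := hv v <;> by_cases e1 : v = x <;> by_cases e2 : v = y <;> grind
  · have : ({z, w, a, b} : Finset V) = insert z (insert w (insert a (insert b ∅))) := rfl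
    rw [this, degIn_insert (by simp; grind), degIn_insert (by simp; grind),
      degIn_insert (by simp; grind), degIn_insert (by simp)] at hdeg
    have h0 : degIn Γ' ∅ x = 0 := by simp [degIn]
    have hxw : Γ'.Adj x w := (hwb.2 ⟨(hx w).2 (by simp), (hy w).2 (by simp)⟩).1
    rw [h0, if_pos hxz.1, if_pos hxw] at hdeg
    by_cases h1 : Γ'.Adj x a
    · have h2 : ¬ Γ'.Adj x b := by intro h2; simp [h1, h2] at hdeg
      refine ne_of_forall_ne_comap hne (hag.eq ?_ ?_) <;> intro v <;> unfold IsLink at hz <;>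
        have := hv v <;> by_cases e1 : v = x <;> by_cases e2 : v = y <;> grind
    · have h2 : Γ'.Adj x b := by by_contra h2; simp [h1, h2] at hdeg
      refine hne (Equiv.swap x y) (hag.eq_comap_swap ?_ ?_).symm <;> intro v <;>
        unfold IsLink at hz <;> have := hv v <;> by_cases e1 : v = x <;> by_cases e2 : v = y <;>
        grind [Equiv.swap_apply_left, Equiv.swap_apply_right, Equiv.swap_apply_of_ne_of_ne]

/-- Replacing a member of the family by its alternative obtained from deleting `x` and `y`
exchanges one private neighbour of `x` with one of `y`. -/
lemma IsAltFamily.switch (hK : IsAltFamily K) (hΓ : K Γ) (hxy : x ≠ y)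
    {z z' a₁ a₂ b₁ b₂ : V} (hz : IsLink x y z z') (hd : [z, a₁, a₂, b₁, b₂].Nodup)
    (ha₁ : a₁ ≠ y) (ha₂ : a₂ ≠ y) (hb₁ : b₁ ≠ x) (hb₂ : b₂ ≠ x)
    (hx : ∀ v, Γ.Adj x v ↔ v = z ∨ v = a₁ ∨ v = a₂)
    (hy : ∀ v, Γ.Adj y v ↔ v = z' ∨ v = b₁ ∨ v = b₂) :
    ∃ Γ', K Γ' ∧ AgreeOff Γ Γ' x y ∧
      (((∀ v, Γ'.Adj x v ↔ v = z ∨ v = a₁ ∨ v = b₁) ∧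
        (∀ v, Γ'.Adj y v ↔ v = z' ∨ v = a₂ ∨ v = b₂)) ∨
      ((∀ v, Γ'.Adj x v ↔ v = z ∨ v = a₁ ∨ v = b₂) ∧
        (∀ v, Γ'.Adj y v ↔ v = z' ∨ v = a₂ ∨ v = b₁))) := by
  classical
  suffices h : ∃ Γ', K Γ' ∧ AgreeOff Γ Γ' x y ∧
      (∀ e : Equiv.Perm V, Γ' ≠ Γ.comap e) ∧ Γ'.Adj x a₁ by
    obtain ⟨Γ', hΓ', hag, hne, hxa⟩ := h
    obtain ⟨hv, hadj⟩ := hag.adj_and_or hxy (hK.reg _ hΓ) (hK.reg _ hΓ')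
    simp only [List.nodup_cons, List.mem_cons, List.not_mem_nil, not_or, or_false] at hd
    have hax₁ : a₁ ≠ x := by rintro rfl; have := (hx a₁).2 (by simp); simp at this
    have hax₂ : a₂ ≠ x := by rintro rfl; have := (hx a₂).2 (by simp); simp at this
    have hby₁ : b₁ ≠ y := by rintro rfl; have := (hy b₁).2 (by simp); simp at this
    have hby₂ : b₂ ≠ y := by rintro rfl; have := (hy b₂).2 (by simp); simp at this
    have hΓyx := Γ'.adj_comm x y
    have hΓ0 := Γ.adj_comm x y
    have i1 := Γ.irrefl (v := x)
    have i2 := Γ.irrefl (v := y)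
    have i1 := Γ'.irrefl (v := x)
    have i2 := Γ'.irrefl (v := y)
    have hsup : ∀ v, Γ'.Adj x v → v ∈ ({z, a₁, a₂, b₁, b₂} : Finset V) := by
      intro v h
      unfold IsLink at hz
      simp only [Finset.mem_insert, Finset.mem_singleton]
      have := hv v
      by_cases e1 : v = x <;> by_cases e2 : v = y <;> grind
    have hdeg := hK.reg _ hΓ' x
    rw [degIn_univ_eq _ hsup] at hdeg
    have h1 := hv a₁ hax₁ ha₁
    have h2 := hv a₂ hax₂ ha₂
    have h3 := hv b₁ hb₁ hby₁
    have h4 := hv b₂ hb₂ hby₂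
    have hxz : Γ'.Adj x z ∧ Γ'.Adj y z' := by
      unfold IsLink at hz
      have := hv z
      by_cases e1 : z = x <;> by_cases e2 : z = y <;> grind
    have : ({z, a₁, a₂, b₁, b₂} : Finset V) =
      insert z (insert a₁ (insert a₂ (insert b₁ (insert b₂ ∅)))) := rfl
    rw [this, degIn_insert (by simp; grind), degIn_insert (by simp; grind),
      degIn_insert (by simp; grind), degIn_insert (by simp; grind), degIn_insert (by simp)] at hdeg
    have h0 : degIn Γ' ∅ x = 0 := by simp [degIn]
    rw [h0, if_pos hxz.1, if_pos hxa] at hdeg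
    have hna : ¬ Γ'.Adj x a₂ := by
      intro hn
      refine ne_of_forall_ne_comap hne (hag.eq ?_ ?_) <;> intro v <;> unfold IsLink at hz <;>
        have := hv v <;> by_cases e1 : v = x <;> by_cases e2 : v = y <;> grind
    rw [if_neg hna] at hdeg
    refine ⟨Γ', hΓ', hag, ?_⟩
    by_cases c1 : Γ'.Adj x b₁
    · have c2 : ¬ Γ'.Adj x b₂ := by intro h2; simp [c1, h2] at hdeg
      left
      constructor <;> intro v <;> unfold IsLink at hz <;>
        have := hv v <;> by_cases e1 : v = x <;> by_cases e2 : v = y <;> grind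
    · have c2 : Γ'.Adj x b₂ := by by_contra h2; simp [c1, h2] at hdeg
      right
      constructor <;> intro v <;> unfold IsLink at hz <;>
        have := hv v <;> by_cases e1 : v = x <;> by_cases e2 : v = y <;> grind
  obtain ⟨Γ', hΓ', hag, hne⟩ := hK.alt Γ hΓ x y hxy
  by_cases hxa : Γ'.Adj x a₁
  · exact ⟨Γ', hΓ', hag, hne, hxa⟩
  · refine ⟨Γ'.comap (Equiv.swap x y), hK.comap _ hΓ' _, hag.comap_swap, fun e he => ?_, ?_⟩
    · apply hne (e * Equiv.swap x y)
      rw [Equiv.Perm.coe_mul, ← SimpleGraph.comap_comap, he.symm]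
      ext u v
      simp
    · have hax₁ : a₁ ≠ x := by rintro rfl; have := (hx a₁).2 (by simp); simp at this
      have := ((hag.adj_and_or hxy (hK.reg _ hΓ) (hK.reg _ hΓ')).1 a₁ hax₁ ha₁).2.2
        (Or.inl ((hx _).2 (by simp)))
      simpa [Equiv.swap_apply_of_ne_of_ne hax₁ ha₁, hxa] using this

end Switching

section GirthFamily

variable {V : Type*} [Fintype V] [DecidableEq V]

/-- `S` is a core with exactly `g` vertices. -/
def IsTight (Γ : SimpleGraph V) (g : ℕ) (S : Finset V) : Prop :=
  S.card = g ∧ IsCore Γ S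

/-- An alternating family whose members have no core on fewer than `g` vertices, and all the same
number of cores on `g` vertices. -/
structure IsGirthFamily (K : SimpleGraph V → Prop) (g : ℕ) : Prop extends IsAltFamily K where
  three_le : 3 ≤ g
  girth : ∀ Γ, K Γ → ∀ S, IsCore Γ S → g ≤ S.card
  count : ∀ Γ Γ', K Γ → K Γ' → {S | IsTight Γ g S}.ncard = {S | IsTight Γ' g S}.ncard

variable {K : SimpleGraph V → Prop} {g : ℕ} {Γ Γ' : SimpleGraph V} {S R : Finset V} {u v w : V}

namespace IsGirthFamily

lemma degIn_le (hK : IsGirthFamily K g) (hΓ : K Γ) : degIn Γ S v ≤ 3 :=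
  (degIn_mono (Finset.subset_univ S)).trans (hK.reg Γ hΓ v).le

lemma one_le_excess (hK : IsGirthFamily K g) (hΓ : K Γ) (hS : S.Nonempty) (hc : S.card < g) :
    1 ≤ excess Γ S := by
  by_contra h
  obtain ⟨T, hT, hT'⟩ := exists_isCore_of_excess_nonpos hS (by omega : excess Γ S ≤ 0)
  have := hK.girth Γ hΓ T hT'
  have := Finset.card_le_card hT
  omega

lemma excess_nonneg (hK : IsGirthFamily K g) (hΓ : K Γ) (hc : S.card = g) : 0 ≤ excess Γ S := by
  have h3 := hK.three_le
  have hS : S.Nonempty := Finset.card_pos.1 (by omega)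
  have key : ∀ v ∈ S, 2 ≤ excess Γ S + degIn Γ S v := by
    intro v hv
    have hcard := Finset.card_erase_of_mem hv
    have := hK.one_le_excess hΓ (S := S.erase v) (Finset.card_pos.1 (by omega)) (by omega)
    rw [excess_erase hv] at this
    omega
  by_cases h : ∀ v ∈ S, degIn Γ S v = 3
  · have h2 := two_mul_excess Γ S
    rw [Finset.sum_congr rfl h] at h2
    obtain ⟨v, hv⟩ := hS
    have := key v hv
    rw [h v hv] at this
    simp at h2 this
    omega
  · push Not at h
    obtain ⟨v, hv, hd⟩ := h
    have := key v hv
    have := hK.degIn_le hΓ (S := S) (v := v)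
    omega

lemma isTight (hK : IsGirthFamily K g) (hΓ : K Γ) (hc : S.card = g) (h : excess Γ S ≤ 0) :
    IsTight Γ g S := by
  have h3 := hK.three_le
  obtain ⟨T, hT, hT'⟩ := exists_isCore_of_excess_nonpos (Finset.card_pos.1 (by omega)) h
  have := hK.girth Γ hΓ T hT'
  have : T = S := Finset.eq_of_subset_of_card_le hT (by omega)
  exact ⟨hc, this ▸ hT'⟩

lemma excess_eq_zero (hK : IsGirthFamily K g) (hΓ : K Γ) (h : IsTight Γ g S) :
    excess Γ S = 0 :=
  le_antisymm h.2.excess_nonpos (hK.excess_nonneg hΓ h.1)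

lemma degIn_eq_two (hK : IsGirthFamily K g) (hΓ : K Γ) (h : IsTight Γ g S) (hv : v ∈ S) :
    degIn Γ S v = 2 := by
  have h0 := hK.excess_eq_zero hΓ h
  have h2 := two_mul_excess Γ S
  have : ∑ u ∈ S, 2 = ∑ u ∈ S, degIn Γ S u := by
    simp
    omega
  exact ((Finset.sum_eq_sum_iff_of_le h.2.2).1 this v hv).symm

lemma exists_isTight (hK : IsGirthFamily K g) (hΓ : K Γ) (hΓ' : K Γ') (h : IsTight Γ g S)
    (h' : ¬ IsTight Γ' g S) : ∃ T, IsTight Γ' g T ∧ ¬ IsTight Γ g T := by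
  by_contra hn
  push Not at hn
  have : {S | IsTight Γ' g S} ⊂ {S | IsTight Γ g S} := ⟨hn, fun hs => h' (hs h)⟩
  exact (Set.ncard_lt_ncard this (Set.toFinite _)).ne (hK.count Γ Γ' hΓ hΓ').symm

lemma not_triangle (hK : IsGirthFamily K g) (hg : 4 ≤ g) (hΓ : K Γ) (h1 : Γ.Adj u v)
    (h2 : Γ.Adj v w) : ¬ Γ.Adj u w := by
  intro h3
  have h : ({u, v, w} : Finset V).card = 3 := by
    rw [Finset.card_eq_three]
    exact ⟨u, v, w, h1.ne, h3.ne, h2.ne, rfl⟩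
  have := hK.girth Γ hΓ {u, v, w} ⟨by simp, ?_⟩
  · omega
  · intro x hx
    simp only [Finset.mem_insert, Finset.mem_singleton] at hx
    rcases hx with rfl | rfl | rfl
    · exact two_le_degIn (u := v) (w := w) (by simp) (by simp) h2.ne h1 h3
    · exact two_le_degIn (u := u) (w := w) (by simp) (by simp) h3.ne h1.symm h2
    · exact two_le_degIn (u := u) (w := v) (by simp) (by simp) h1.ne h3.symm h2.symm

/-- A `g`-core crossing a set `R` all of whose vertices have a single outside neighbour. -/
lemma crossing (hK : IsGirthFamily K g) (hΓ : K Γ) (st : V → V)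
    (hst : ∀ r ∈ R, ∀ v ∉ R, Γ.Adj r v ↔ v = st r) (hS : IsTight Γ g S)
    (hA : (S ∩ R).Nonempty) (hB : (S \ R).Nonempty)
    (h1 : (((S ∩ R).filter (st · ∈ S \ R)).card : ℤ) ≤ excess Γ (S \ R) + 1)
    (h2 : ((S ∩ R).filter (st · ∈ S \ R)).card < (S ∩ R).card →
      (((S ∩ R).filter (st · ∈ S \ R)).card : ℤ) ≤ excess Γ (S \ R)) :
    ∃ a a', S ∩ R = {a, a'} ∧ Γ.Adj a a' ∧ st a ∈ S \ R ∧ st a' ∈ S \ R ∧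
      (S \ R).card + 2 = g ∧ excess Γ (S \ R) = 1 := by
  classical
  have hf := hK.excess_eq_zero hΓ hS
  have hdeg : ∀ v ∈ S, degIn Γ S v = 2 := fun v => hK.degIn_eq_two hΓ hS
  have hcard := hS.1
  set A := S ∩ R with hAdef
  set B := S \ R with hBdef
  have hAB : Disjoint A B := Finset.disjoint_left.2 fun x h1 h2 => by
    simp only [hAdef, hBdef, Finset.mem_inter, Finset.mem_sdiff] at h1 h2; tauto
  have hU : S = A ∪ B := by
    ext x; simp only [hAdef, hBdef, Finset.mem_union, Finset.mem_inter, Finset.mem_sdiff]; tauto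
  have hdB : ∀ a ∈ A, degIn Γ B a = if st a ∈ B then 1 else 0 := by
    intro a ha
    have haR : a ∈ R := (Finset.mem_inter.1 ha).2
    have : B.filter (Γ.Adj a) = B.filter (· = st a) := by
      refine Finset.filter_congr fun x hx => hst a haR x (Finset.mem_sdiff.1 hx).2
    unfold degIn
    rw [this, Finset.filter_eq']
    split_ifs <;> simp
  have hsum : ∑ a ∈ A, degIn Γ B a = (A.filter (st · ∈ B)).card := by
    rw [Finset.sum_congr rfl hdB, Finset.card_filter]
  rw [hU, excess_union hAB, hsum] at hf
  have hcU : S.card = A.card + B.card := by rw [hU, Finset.card_union_of_disjoint hAB]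
  have hBpos := Finset.card_pos.2 hB
  have hfA := hK.one_le_excess hΓ hA (by omega)
  have hle : (A.filter (st · ∈ B)).card ≤ A.card := Finset.card_filter_le _ _
  have hfull : A.filter (st · ∈ B) = A := by
    refine Finset.eq_of_subset_of_card_le (Finset.filter_subset _ _) ?_
    by_contra hlt
    have := h2 (by omega)
    omega
  rw [hfull] at h1 hf
  have hall : ∀ a ∈ A, st a ∈ B := fun a ha => by
    rw [← hfull] at ha; exact (Finset.mem_filter.1 ha).2
  have hd1 : ∀ a ∈ A, degIn Γ A a = 1 := by
    intro a ha
    have := hdeg a (Finset.mem_inter.1 ha).1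
    rw [hU, degIn_union hAB, hdB a ha, if_pos (hall a ha)] at this
    omega
  have h2A := two_mul_excess Γ A
  rw [Finset.sum_congr rfl hd1] at h2A
  simp at h2A
  obtain ⟨a, a', haa, hAeq⟩ := Finset.card_eq_two.1 (by omega : A.card = 2)
  refine ⟨a, a', hAeq, ?_, hall a (by simp [hAeq]), hall a' (by simp [hAeq]), by omega, by omega⟩
  have hd := hd1 a (by simp [hAeq])
  have hpos : 0 < degIn Γ A a := by omega
  obtain ⟨z, hz, hadj⟩ := degIn_pos_iff.1 hpos
  simp only [hAeq, Finset.mem_insert, Finset.mem_singleton] at hz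
  rcases hz with rfl | rfl
  · simp at hadj
  · exact hadj

end IsGirthFamily

end GirthFamily

lemma exists_perm_extending {ι α : Type*} [Finite α] {p q : ι → α} (hp : p.Injective)
    (hq : q.Injective) : ∃ σ : Equiv.Perm α, ∀ i, σ (p i) = q i := by
  classical
  have := Fintype.ofFinite α
  let e : {x // x ∈ Set.range p} ≃ {x // x ∈ Set.range q} :=
    (Equiv.ofInjective p hp).symm.trans (Equiv.ofInjective q hq)
  refine ⟨e.extendSubtype, fun i => ?_⟩
  rw [Equiv.extendSubtype_apply_of_mem e (p i) ⟨i, rfl⟩]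
  have : (⟨p i, ⟨i, rfl⟩⟩ : {x // x ∈ Set.range p}) = Equiv.ofInjective p hp i := rfl
  simp only [e, Equiv.trans_apply]
  rw [this, Equiv.symm_apply_apply]
  rfl

section FinNumerals

variable {m : ℕ}

lemma fin_nodup : [(0 : Fin (m + 5)), 1, 2, 3, 4].Nodup := by
  have h : ∀ k : ℕ, k < 5 → k % (m + 5) = k := fun k hk => Nat.mod_eq_of_lt (by omega)
  apply List.Nodup.of_map Fin.val
  have : [(0 : Fin (m + 5)), 1, 2, 3, 4].map Fin.val = [0, 1, 2, 3, 4] := by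
    simp [Fin.coe_ofNat_eq_mod, h]
  rw [this]
  decide

lemma fin_add_nodup (i : Fin (m + 5)) : [i, i + 1, i + 2, i + 3, i + 4].Nodup := by
  have h : [i, i + 1, i + 2, i + 3, i + 4] = [(0 : Fin (m + 5)), 1, 2, 3, 4].map (i + ·) := by simp
  rw [h]
  exact fin_nodup.map (add_right_injective i)

lemma fin_add_one_add_one (i : Fin (m + 5)) : i + 1 + 1 = i + 2 := by
  rw [add_assoc]; congr 1

lemma fin_add_two_add_one (i : Fin (m + 5)) : i + 2 + 1 = i + 3 := by
  rw [add_assoc]; congr 1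

end FinNumerals

section Ring

variable {V : Type*} [Fintype V] [DecidableEq V] {m : ℕ}

/-- The vertices enumerated by `c`. -/
def ringSet (c : Fin (m + 5) → V) : Finset V := Finset.univ.image c

/-- In `Γ`, the map `c` enumerates an induced cycle, the vertex `c i` has the unique outside
neighbour `d (σ i)`, and off the cycle `Γ` agrees with `O`. -/
structure IsState (K : SimpleGraph V → Prop) (c d : Fin (m + 5) → V) (O : SimpleGraph V)
    (σ : Equiv.Perm (Fin (m + 5))) (Γ : SimpleGraph V) : Prop where
  mem : K Γ
  ring : ∀ i j, Γ.Adj (c i) (c j) ↔ j = i + 1 ∨ i = j + 1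
  off : ∀ u v, u ∉ ringSet c → v ∉ ringSet c → (Γ.Adj u v ↔ O.Adj u v)
  stub : ∀ i v, v ∉ ringSet c → (Γ.Adj (c i) v ↔ v = d (σ i))

structure IsRing (K : SimpleGraph V → Prop) (c d : Fin (m + 5) → V) (O : SimpleGraph V) :
    Prop where
  fam : IsGirthFamily K (m + 5)
  inj : Function.Injective c
  notMem : ∀ i, d i ∉ ringSet c
  init : IsState K c d O 1 O

variable {K : SimpleGraph V → Prop} {c d : Fin (m + 5) → V} {O Γ Γ' : SimpleGraph V}
  {σ : Equiv.Perm (Fin (m + 5))} {B : Finset V} {u v w : V}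

lemma mem_ringSet : v ∈ ringSet c ↔ ∃ i, c i = v := by simp [ringSet]

lemma IsGirthFamily.false_of_insert {g : ℕ} (hK : IsGirthFamily K g) (hΓ : K Γ)
    (hB : excess Γ B ≤ 1) (hc : B.card + 1 < g) (hw : w ∉ B) (hu : u ∈ B) (hv : v ∈ B)
    (huv : u ≠ v) (h1 : Γ.Adj w u) (h2 : Γ.Adj w v) : False := by
  have := hK.one_le_excess hΓ (S := insert w B) (by simp)
    (by rw [Finset.card_insert_of_notMem hw]; omega)
  rw [excess_insert hw] at this
  have := two_le_degIn hu hv huv h1 h2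
  omega

lemma IsGirthFamily.false_of_insert_insert {g : ℕ} (hK : IsGirthFamily K g) (hΓ : K Γ)
    (hB : excess Γ B ≤ 1) (hc : B.card + 2 < g) {x y : V} (hx : x ∉ B) (hy : y ∉ B)
    (hxy : Γ.Adj x y) (hu : u ∈ B) (hv : v ∈ B) (h1 : Γ.Adj x u) (h2 : Γ.Adj y v) : False := by
  have := hK.one_le_excess hΓ (S := insert x (insert y B)) (by simp)
    (by rw [card_insert_insert hx hy hxy.ne]; omega)
  have := excess_insert_insert_le hx hy hxy (one_le_degIn hu h1) (one_le_degIn hv h2)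
  omega

namespace IsRing

lemma card_ringSet (hR : IsRing K c d O) : (ringSet c).card = m + 5 := by
  rw [ringSet, Finset.card_image_of_injective _ hR.inj]
  simp

lemma mem_c (i : Fin (m + 5)) : c i ∈ ringSet c := mem_ringSet.2 ⟨i, rfl⟩

lemma c_ne (hR : IsRing K c d O) (i : Fin (m + 5)) : [c i, c (i + 1), c (i + 2), c (i + 3)].Nodup := by
  have := (fin_add_nodup i).map hR.inj
  simp only [List.map_cons, List.nodup_cons, List.mem_cons] at this ⊢
  tauto

end IsRing

namespace IsState

lemma isTight (hR : IsRing K c d O) (h : IsState K c d O σ Γ) :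
    IsTight Γ (m + 5) (ringSet c) := by
  refine ⟨hR.card_ringSet, ⟨c 0, IsRing.mem_c 0⟩, fun v hv => ?_⟩
  obtain ⟨i, rfl⟩ := mem_ringSet.1 hv
  obtain ⟨j, rfl⟩ : ∃ j, i = j + 1 := ⟨i - 1, by simp⟩
  have := hR.c_ne j
  simp only [List.nodup_cons, List.mem_cons] at this
  refine two_le_degIn (u := c j) (w := c (j + 2)) (IsRing.mem_c _) (IsRing.mem_c _)
    (by tauto) ?_ ?_
  · rw [h.ring]; right; rfl
  · rw [h.ring]; left; rw [fin_add_one_add_one]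

lemma excess_off (h : IsState K c d O σ Γ) (hB : Disjoint B (ringSet c)) :
    excess Γ B = excess O B :=
  excess_congr fun u hu v hv => h.off u v (Finset.disjoint_left.1 hB hu)
    (Finset.disjoint_left.1 hB hv)

lemma adj_c (hR : IsRing K c d O) (h : IsState K c d O σ Γ) (i : Fin (m + 5)) (v : V) :
    Γ.Adj (c (i + 1)) v ↔ v = c i ∨ v = c (i + 2) ∨ v = d (σ (i + 1)) := by
  by_cases hv : v ∈ ringSet c
  · obtain ⟨k, rfl⟩ := mem_ringSet.1 hv
    have : c k ≠ d (σ (i + 1)) := fun hk => hR.notMem _ (hk ▸ hv)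
    simp only [h.ring, hR.inj.eq_iff, add_left_inj, fin_add_one_add_one, this, or_false]
    tauto
  · rw [h.stub _ _ hv]
    have h1 : v ≠ c i := fun hk => hv (hk ▸ IsRing.mem_c i)
    have h2 : v ≠ c (i + 2) := fun hk => hv (hk ▸ IsRing.mem_c _)
    simp [h1, h2]

lemma stub_ne_succ (hR : IsRing K c d O) (h : IsState K c d O σ Γ) (i : Fin (m + 5)) :
    d (σ i) ≠ d (σ (i + 1)) := by
  intro he
  have h1 : Γ.Adj (c i) (c (i + 1)) := by simp [h.ring]
  refine hR.fam.not_triangle (by omega) h.mem h1 (w := d (σ i)) ?_ ?_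
  · rw [h.stub _ _ (hR.notMem _), he]
  · rw [h.stub _ _ (hR.notMem _)]

lemma excess_erase_two (hR : IsRing K c d O) (h : IsState K c d O σ Γ) (i : Fin (m + 5)) :
    excess Γ (((ringSet c).erase (c (i + 1))).erase (c (i + 2))) ≤ 1 := by
  have hn := hR.c_ne i
  simp only [List.nodup_cons, List.mem_cons, List.not_mem_nil, not_or, or_false] at hn
  have ht := h.isTight hR
  have h0 := hR.fam.excess_eq_zero h.mem ht
  have h2 := hR.fam.degIn_eq_two h.mem ht (IsRing.mem_c (i + 1))
  have h3 := hR.fam.degIn_eq_two h.mem ht (IsRing.mem_c (i + 2))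
  have h1 := excess_erase (Γ := Γ) (IsRing.mem_c (c := c) (i + 1))
  have hm : c (i + 2) ∈ (ringSet c).erase (c (i + 1)) :=
    Finset.mem_erase.2 ⟨Ne.symm hn.2.1.1, IsRing.mem_c _⟩
  rw [excess_erase hm]
  have hd := degIn_insert (Γ := Γ) (u := c (i + 2)) (Finset.notMem_erase (c (i + 1)) (ringSet c))
  rw [Finset.insert_erase (IsRing.mem_c _), h3, if_pos] at hd
  · omega
  · rw [h.ring]; right; rw [fin_add_one_add_one]

/-- The stubs at two consecutive positions can be exchanged. -/
lemma exists_swap_succ (hR : IsRing K c d O) (h : IsState K c d O σ Γ) (i : Fin (m + 5)) :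
    ∃ Γ', IsState K c d O (σ * Equiv.swap (i + 1) (i + 2)) Γ' := by
  have hn := hR.c_ne i
  simp only [List.nodup_cons, List.mem_cons, List.not_mem_nil, not_or, or_false] at hn
  obtain ⟨⟨n01, n02, n03⟩, ⟨n12, n13⟩, n23, -⟩ := hn
  have hx := h.adj_c hR i
  have hy := h.adj_c hR (i + 1)
  have hs := h.stub_ne_succ hR (i + 1)
  rw [fin_add_one_add_one] at hy hs
  have e3 : i + 1 + 2 = i + 3 := by rw [add_right_comm, fin_add_two_add_one]
  rw [e3] at hy
  have hcd : ∀ k l, c k ≠ d l := fun k l hk => hR.notMem l (hk ▸ IsRing.mem_c k)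
  have hdc : ∀ k l, d k ≠ c l := fun k l => (hcd l k).symm
  obtain ⟨Γ', hΓ', hag, hcase⟩ := hR.fam.switch h.mem (x := c (i + 1)) (y := c (i + 2))
    (z := c (i + 2)) (z' := c (i + 1)) (a₁ := c i) (a₂ := d (σ (i + 1))) (b₁ := c (i + 3))
    (b₂ := d (σ (i + 2))) n12 (Or.inl ⟨rfl, rfl⟩)
    (by simp [hcd, hdc, hs, n03, Ne.symm n02, n23]) n02 (hcd _ _).symm (Ne.symm n13)
    (hcd _ _).symm (fun v => by rw [hx, or_left_comm]) (fun v => by rw [hy])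
  have hoff : ∀ B : Finset V, c (i + 1) ∉ B → c (i + 2) ∉ B → excess Γ' B = excess Γ B := by
    intro B h1 h2
    refine excess_congr fun u hu v hv => (hag u v ?_ ?_ ?_ ?_).symm <;> rintro rfl <;> contradiction
  rcases hcase with ⟨hx', -⟩ | ⟨hx', hy'⟩
  · exfalso
    have hcard : (((ringSet c).erase (c (i + 1))).erase (c (i + 2))).card = m + 3 := by
      rw [Finset.card_erase_of_mem, Finset.card_erase_of_mem (IsRing.mem_c _), hR.card_ringSet]
      · omega
      · exact Finset.mem_erase.2 ⟨Ne.symm n12, IsRing.mem_c _⟩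
    refine hR.fam.false_of_insert hΓ' (B := ((ringSet c).erase (c (i + 1))).erase (c (i + 2)))
      (w := c (i + 1)) (u := c i) (v := c (i + 3)) ?_ (by omega) (by simp) ?_ ?_ n03
      ((hx' _).2 (by simp)) ((hx' _).2 (by simp))
    · rw [hoff _ (by simp) (by simp)]
      exact h.excess_erase_two hR i
    · simp only [Finset.mem_erase, IsRing.mem_c, and_true]
      exact ⟨n02, n01⟩
    · simp only [Finset.mem_erase, IsRing.mem_c, and_true]
      exact ⟨Ne.symm n23, Ne.symm n13⟩
  · have hd : ∀ i v, v ∉ ringSet c → v ≠ c i := fun i v hv hk => hv (hk ▸ IsRing.mem_c i)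
    have hpos : ∀ k, (k = i + 1 ∨ k = i + 2) ∨ (c k ≠ c (i + 1) ∧ c k ≠ c (i + 2)) := by
      intro k
      rw [hR.inj.ne_iff, hR.inj.ne_iff]
      by_cases k = i + 1 <;> by_cases k = i + 2 <;> simp [*]
    refine ⟨Γ', hΓ', fun k l => ?_, fun u v hu hv => ?_, fun k v hv => ?_⟩
    · have hx1 : ∀ l, Γ'.Adj (c (i + 1)) (c l) ↔ l = i + 1 + 1 ∨ i + 1 = l + 1 := by
        intro l
        simp only [hx', hR.inj.eq_iff, fin_add_one_add_one, hcd, add_left_inj, or_false]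
        rw [@eq_comm _ l i]
      have hy1 : ∀ l, Γ'.Adj (c (i + 2)) (c l) ↔ l = i + 2 + 1 ∨ i + 2 = l + 1 := by
        intro l
        rw [hy', fin_add_two_add_one, ← fin_add_one_add_one i]
        simp only [hR.inj.eq_iff, hcd, add_left_inj, false_or]
        rw [@eq_comm _ l (i + 1), or_comm]
      rcases hpos k with (rfl | rfl) | hk
      · exact hx1 l
      · exact hy1 l
      rcases hpos l with (rfl | rfl) | hl
      · rw [Γ'.adj_comm, hx1, or_comm]
      · rw [Γ'.adj_comm, hy1, or_comm]
      rw [← hag _ _ hk.1 hk.2 hl.1 hl.2, h.ring]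
    · rw [← hag u v (hd _ _ hu) (hd _ _ hu) (hd _ _ hv) (hd _ _ hv), h.off u v hu hv]
    · have h1 := fun j => hd j v hv
      rcases hpos k with (rfl | rfl) | hk
      · simp [hx', h1]
      · simp [hy', h1]
      · rw [← hag _ _ hk.1 hk.2 (hd _ _ hv) (hd _ _ hv), h.stub _ _ hv, Equiv.Perm.mul_apply,
          Equiv.swap_apply_of_ne_of_ne]
        · rintro rfl; exact hk.1 rfl
        · rintro rfl; exact hk.2 rfl

end IsState

namespace IsRing

open scoped Fin.CommRing in
lemma exists_swap_add (hR : IsRing K c d O) (i : Fin (m + 5)) (n : ℕ) :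
    ∀ σ, (∃ Γ, IsState K c d O σ Γ) →
      ∃ Γ, IsState K c d O (σ * Equiv.swap i (i + (n : Fin (m + 5)))) Γ := by
  have hsucc : ∀ j σ, (∃ Γ, IsState K c d O σ Γ) →
      ∃ Γ, IsState K c d O (σ * Equiv.swap j (j + 1)) Γ := by
    rintro j σ ⟨Γ, h⟩
    obtain ⟨k, rfl⟩ : ∃ k, j = k + 1 := ⟨j - 1, by simp⟩
    rw [fin_add_one_add_one]
    exact h.exists_swap_succ hR k
  induction n with
  | zero => intro σ h; simpa [Equiv.swap_self, ← Equiv.Perm.one_def] using h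
  | succ n ih =>
    intro σ h
    push_cast
    rw [← add_assoc]
    by_cases h1 : (i + (n : Fin (m + 5))) = i
    · rw [h1]; exact hsucc i σ h
    by_cases h2 : (i + (n : Fin (m + 5))) + 1 = i
    · rw [h2]; simpa [Equiv.swap_self, ← Equiv.Perm.one_def] using h
    · have := ih _ (hsucc (i + n) _ (ih σ h))
      have e : Equiv.swap i (i + (n : Fin (m + 5)) + 1) =
          Equiv.swap i (i + (n : Fin (m + 5))) *
            Equiv.swap (i + (n : Fin (m + 5))) (i + (n : Fin (m + 5)) + 1) *
            Equiv.swap i (i + (n : Fin (m + 5))) := by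
        rw [Equiv.swap_comm i (i + (n : Fin (m + 5))), Equiv.swap_comm _ (i + (n : Fin (m + 5)) + 1),
          Equiv.swap_comm (i + (n : Fin (m + 5))) (_ + 1), Equiv.swap_mul_swap_mul_swap (by simp) h2,
          Equiv.swap_comm]
      rw [e]
      simpa [mul_assoc] using this

open scoped Fin.CommRing in
lemma exists_isState (hR : IsRing K c d O) (σ : Equiv.Perm (Fin (m + 5))) :
    ∃ Γ, IsState K c d O σ Γ := by
  induction σ using Equiv.Perm.swap_induction_on' with
  | one => exact ⟨O, hR.init⟩
  | mul_swap σ i j hij ih =>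
    have := hR.exists_swap_add i (j - i).val σ ih
    simpa using this

/-- Prescribed stubs can be moved to prescribed positions. -/
lemma exists_isState_of_injective (hR : IsRing K c d O) {ι : Type*} {p q : ι → Fin (m + 5)}
    (hp : p.Injective) (hq : q.Injective) :
    ∃ σ Γ, IsState K c d O σ Γ ∧ ∀ i, σ (p i) = q i := by
  obtain ⟨σ, hσ⟩ := exists_perm_extending hp hq
  obtain ⟨Γ, h⟩ := hR.exists_isState σ
  exact ⟨σ, Γ, h, hσ⟩

lemma stub_injective (hR : IsRing K c d O) : Function.Injective d := by
  intro a b hab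
  by_contra hne
  obtain ⟨σ, Γ, h, hσ⟩ := hR.exists_isState_of_injective (p := ![(0 : Fin (m + 5)), 1])
    (q := ![a, b]) (by simp [Function.Injective, Fin.forall_fin_two])
    (by simpa [Function.Injective, Fin.forall_fin_two] using ⟨hne, Ne.symm hne⟩)
  have h0 := hσ 0
  have h1 := hσ 1
  simp at h0 h1
  have := h.stub_ne_succ hR 0
  rw [zero_add, h0, h1] at this
  exact this hab

end IsRing
end Ring

section Bridges

variable {V : Type*} [Fintype V] [DecidableEq V] {m : ℕ}
  {K : SimpleGraph V → Prop} {c d : Fin (m + 5) → V} {O Γ Γ' : SimpleGraph V}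
  {σ : Equiv.Perm (Fin (m + 5))} {B S : Finset V} {u v w : V}

/-- Attaching `B` to two consecutive cycle vertices with stubs `d a` and `d b` gives a core on
`m + 5` vertices. -/
structure IsBridge (c d : Fin (m + 5) → V) (O : SimpleGraph V) (B : Finset V)
    (a b : Fin (m + 5)) : Prop where
  disj : Disjoint B (ringSet c)
  card : B.card + 2 = m + 5
  left : d a ∈ B
  right : d b ∈ B
  excess_le : excess O B ≤ 1

lemma IsBridge.symm {a b : Fin (m + 5)} (h : IsBridge c d O B a b) : IsBridge c d O B b a :=
  ⟨h.disj, h.card, h.right, h.left, h.excess_le⟩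

lemma IsState.of_disjoint (h : IsState K c d O σ Γ) (hB : Disjoint B (ringSet c)) :
    ∀ u ∈ B, ∀ v ∈ B, (Γ.Adj u v ↔ O.Adj u v) := fun u hu v hv =>
  h.off u v (Finset.disjoint_left.1 hB hu) (Finset.disjoint_left.1 hB hv)

/-- A set off the cycle attached to the first `k` cycle vertices. -/
lemma excess_union_le (hR : IsRing K c d O) (h : IsState K c d O σ Γ)
    (hB : Disjoint B (ringSet c)) (n : ℕ) (hn : n ≤ m + 5)
    (hd : ∀ i : Fin (m + 5), i.val < n → d (σ i) ∈ B) :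
    let X := B ∪ (Finset.univ.filter fun i : Fin (m + 5) => i.val < n).image c
    X.card = B.card + n ∧ excess Γ X ≤ excess O B + 1 - n - if n = 0 then 1 else 0 := by
  induction n with
  | zero => simp [h.excess_off hB]
  | succ n ih =>
    obtain ⟨ih1, ih2⟩ := ih (by omega) fun i hi => hd i (by omega)
    intro X
    let k : Fin (m + 5) := ⟨n, by omega⟩
    set Y := B ∪ (Finset.univ.filter fun i : Fin (m + 5) => i.val < n).image c with hY
    have hk : c k ∉ Y := by
      simp only [hY, Finset.mem_union, Finset.mem_image, Finset.mem_filter, Finset.mem_univ,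
        true_and, not_or, not_exists, not_and]
      refine ⟨fun hb => Finset.disjoint_left.1 hB hb (IsRing.mem_c k), fun i hi hc => ?_⟩
      rw [hR.inj hc] at hi
      exact lt_irrefl _ hi
    have hX : X = insert (c k) Y := by
      have : (Finset.univ.filter fun i : Fin (m + 5) => i.val < n + 1) =
          insert k (Finset.univ.filter fun i : Fin (m + 5) => i.val < n) := by
        ext i
        simp only [Finset.mem_filter, Finset.mem_univ, true_and, Finset.mem_insert, Fin.ext_iff, k]
        omega
      simp only [X, hY, this, Finset.image_insert, Finset.union_insert]
    have hstub : d (σ k) ∈ Y := Finset.mem_union_left _ (hd k (by simp [k]))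
    have hadj : Γ.Adj (c k) (d (σ k)) := (h.stub _ _ (hR.notMem _)).2 rfl
    rw [hX, Finset.card_insert_of_notMem hk, excess_insert hk]
    refine ⟨by omega, ?_⟩
    rcases Nat.eq_zero_or_pos n with rfl | hpos
    · have := one_le_degIn hstub hadj
      simp at ih2 ⊢
      omega
    · let j : Fin (m + 5) := ⟨n - 1, by omega⟩
      have hj : k = j + 1 := by
        apply Fin.ext
        rw [Fin.val_add_one_of_lt' (by simp [j]; omega)]
        simp [j, k]
        omega
      have hjY : c j ∈ Y := Finset.mem_union_right _
        (Finset.mem_image_of_mem _ (by simp [j]; omega))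
      have hne : d (σ k) ≠ c j := fun he =>
        hR.notMem (σ k) (by rw [he]; exact IsRing.mem_c j)
      have := two_le_degIn hstub hjY hne hadj ((h.ring _ _).2 (Or.inr hj))
      rw [if_neg (by omega)] at ih2 ⊢
      push_cast
      omega

lemma IsRing.card_le_excess (hR : IsRing K c d O) (hB : Disjoint B (ringSet c))
    (hne : B.Nonempty) (J : Finset (Fin (m + 5))) (hJ : ∀ j ∈ J, d j ∈ B)
    (hc : B.card + J.card ≤ m + 5) :
    (J.card : ℤ) ≤ excess O B + 1 ∧ (B.card + J.card < m + 5 → (J.card : ℤ) ≤ excess O B) := by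
  have hp := Finset.card_pos.2 hne
  obtain ⟨σ, Γ, h, hσ⟩ := hR.exists_isState_of_injective
    (p := Fin.castLE (by omega : J.card ≤ m + 5)) (q := fun k => (J.equivFin.symm k : Fin (m + 5)))
    (Fin.castLE_injective _) (Subtype.val_injective.comp (Equiv.injective _))
  obtain ⟨h1, h2⟩ := excess_union_le hR h hB J.card (by omega) (fun i hi => by
    have := hσ ⟨i, hi⟩
    rw [show Fin.castLE (by omega : J.card ≤ m + 5) ⟨i, hi⟩ = i from rfl] at this
    rw [this]
    exact hJ _ (Subtype.property _))
  constructor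
  · rcases hc.lt_or_eq with hlt | heq
    · have := hR.fam.one_le_excess h.mem (hne.mono Finset.subset_union_left) (by rw [h1]; exact hlt)
      split_ifs at h2 <;> omega
    · have := hR.fam.excess_nonneg h.mem (h1.trans heq)
      split_ifs at h2 <;> omega
  · intro hlt
    have := hR.fam.one_le_excess h.mem (hne.mono Finset.subset_union_left) (by rw [h1]; exact hlt)
    split_ifs at h2 <;> omega

lemma IsState.isTight_insert_insert (hR : IsRing K c d O) (h : IsState K c d O σ Γ)
    {i : Fin (m + 5)} (hB : IsBridge c d O B (σ i) (σ (i + 1))) :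
    IsTight Γ (m + 5) (insert (c i) (insert (c (i + 1)) B)) := by
  have hn : ∀ k, c k ∉ B := fun k hk => Finset.disjoint_left.1 hB.disj hk (IsRing.mem_c k)
  have hadj : Γ.Adj (c i) (c (i + 1)) := by simp [h.ring]
  refine hR.fam.isTight h.mem ?_ ?_
  · rw [card_insert_insert (hn _) (hn _) hadj.ne, hB.card]
  · have := excess_insert_insert_le (hn _) (hn _) hadj
      (one_le_degIn hB.left ((h.stub _ _ (hR.notMem _)).2 rfl))
      (one_le_degIn hB.right ((h.stub _ _ (hR.notMem _)).2 rfl))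
    have := h.excess_off hB.disj
    have := hB.excess_le
    omega

lemma IsState.crossing (hR : IsRing K c d O) (h : IsState K c d O σ Γ)
    (hS : IsTight Γ (m + 5) S) (hA : (S ∩ ringSet c).Nonempty) (hB : (S \ ringSet c).Nonempty) :
    ∃ i, IsBridge c d O (S \ ringSet c) (σ i) (σ (i + 1)) ∧ S ∩ ringSet c = {c i, c (i + 1)} := by
  let st : V → V := Function.extend c (fun i => d (σ i)) id
  have hst : ∀ i, st (c i) = d (σ i) := fun i => hR.inj.extend_apply _ _ i
  have hdisj : Disjoint (S \ ringSet c) (ringSet c) := Finset.sdiff_disjoint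
  let I : Finset (Fin (m + 5)) := Finset.univ.filter fun i => c i ∈ S ∧ d (σ i) ∈ S \ ringSet c
  have hI : ((S ∩ ringSet c).filter (st · ∈ S \ ringSet c)) = I.image c := by
    ext x
    simp only [Finset.mem_filter, Finset.mem_inter, mem_ringSet, Finset.mem_image, I,
      Finset.mem_univ, true_and]
    constructor
    · rintro ⟨⟨h1, i, rfl⟩, h2⟩
      rw [hst] at h2
      exact ⟨i, ⟨h1, h2⟩, rfl⟩
    · rintro ⟨i, ⟨h1, h2⟩, rfl⟩
      rw [hst]
      exact ⟨⟨h1, i, rfl⟩, h2⟩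
  have hcI : ((S ∩ ringSet c).filter (st · ∈ S \ ringSet c)).card = (I.image σ).card := by
    rw [hI, Finset.card_image_of_injective _ hR.inj,
      Finset.card_image_of_injective _ σ.injective]
  have hle : ((S ∩ ringSet c).filter (st · ∈ S \ ringSet c)).card ≤ (S ∩ ringSet c).card :=
    Finset.card_filter_le _ _
  have hcard := Finset.card_inter_add_card_sdiff S (ringSet c)
  rw [hS.1] at hcard
  have hY := hR.card_le_excess hdisj hB (I.image σ) (by
    intro j hj
    obtain ⟨i, hi, rfl⟩ := Finset.mem_image.1 hj
    exact (Finset.mem_filter.1 hi).2.2) (by omega)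
  rw [← hcI, ← h.excess_off hdisj] at hY
  obtain ⟨a, a', hAeq, hadj, ha, ha', hBc, hBe⟩ := hR.fam.crossing h.mem st
    (R := ringSet c) (by
      intro r hr v hv
      obtain ⟨i, rfl⟩ := mem_ringSet.1 hr
      rw [h.stub _ _ hv, hst]) hS hA hB hY.1 (fun hlt => hY.2 (by omega))
  have hm : a ∈ S ∩ ringSet c := by simp [hAeq]
  have hm' : a' ∈ S ∩ ringSet c := by simp [hAeq]
  obtain ⟨i, rfl⟩ := mem_ringSet.1 (Finset.mem_inter.1 hm).2
  obtain ⟨j, rfl⟩ := mem_ringSet.1 (Finset.mem_inter.1 hm').2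
  rw [hst] at ha ha'
  rw [h.excess_off hdisj] at hBe
  rcases (h.ring i j).1 hadj with rfl | rfl
  · exact ⟨i, ⟨hdisj, hBc, ha, ha', hBe.le⟩, hAeq⟩
  · exact ⟨j, ⟨hdisj, hBc, ha', ha, hBe.le⟩, by rw [hAeq, Finset.pair_comm]⟩

end Bridges

section Exchange

variable {V : Type*} [Fintype V] [DecidableEq V] {m : ℕ}
  {K : SimpleGraph V → Prop} {c d : Fin (m + 5) → V} {O Γ Γ' : SimpleGraph V}
  {σ σ' : Equiv.Perm (Fin (m + 5))} {B S : Finset V} {u v w s t : V} {o j k : Fin (m + 5)}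

lemma eq_insert_insert_of_inter {R : Finset V} {a b : V} (h : S ∩ R = {a, b}) :
    S = insert a (insert b (S \ R)) := by
  conv_lhs => rw [← Finset.sdiff_union_inter S R, h]
  ext
  simp

lemma insert_insert_inter {R : Finset V} (hB : Disjoint B R) {a b : V} (ha : a ∈ R) (hb : b ∈ R) :
    insert a (insert b B) ∩ R = {a, b} := by
  rw [Finset.insert_inter_of_mem ha, Finset.insert_inter_of_mem hb,
    Finset.disjoint_iff_inter_eq_empty.1 hB]
  rfl

lemma insert_insert_sdiff {R : Finset V} (hB : Disjoint B R) {a b : V} (ha : a ∈ R) (hb : b ∈ R) :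
    insert a (insert b B) \ R = B := by
  rw [Finset.insert_sdiff_of_mem _ ha, Finset.insert_sdiff_of_mem _ hb,
    Finset.sdiff_eq_self_of_disjoint hB]

lemma fin_succ_ne (i : Fin (m + 5)) : i + 1 ≠ i := by
  have := fin_add_nodup i
  simp only [List.nodup_cons, List.mem_cons, not_or] at this
  exact Ne.symm this.1.1

lemma fin_succ_succ_ne (i : Fin (m + 5)) : i + 1 + 1 ≠ i := by
  have := fin_add_nodup i
  simp only [List.nodup_cons, List.mem_cons, not_or] at this
  rw [fin_add_one_add_one]
  exact Ne.symm this.1.2.1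

lemma IsRing.pair_injective (hR : IsRing K c d O) {i k : Fin (m + 5)}
    (h : ({c k, c (k + 1)} : Finset V) = {c i, c (i + 1)}) : k = i := by
  have h1 : c k ∈ ({c i, c (i + 1)} : Finset V) := by simp [← h]
  have h2 : c (k + 1) ∈ ({c i, c (i + 1)} : Finset V) := by simp [← h]
  simp only [Finset.mem_insert, Finset.mem_singleton, hR.inj.eq_iff] at h1 h2
  rcases h1 with h1 | rfl
  · exact h1
  · rcases h2 with h2 | h2
    · exact absurd h2 (fin_succ_succ_ne i)
    · exact absurd h2 (fin_succ_ne _)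

/-- A bridge in one state forces a bridge in any other state, and a new one unless it survives. -/
lemma IsState.exists_isBridge (hR : IsRing K c d O) (h : IsState K c d O σ Γ)
    (h' : IsState K c d O σ' Γ') {i : Fin (m + 5)} (hB : IsBridge c d O B (σ i) (σ (i + 1))) :
    ∃ B' k, IsBridge c d O B' (σ' k) (σ' (k + 1)) ∧
      (k = i ∨ ¬ IsBridge c d O B' (σ k) (σ (k + 1))) := by
  have hS := h.isTight_insert_insert hR hB
  have hi := IsRing.mem_c (c := c) i
  have hi' := IsRing.mem_c (c := c) (i + 1)
  by_cases hS' : IsTight Γ' (m + 5) (insert (c i) (insert (c (i + 1)) B))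
  · obtain ⟨k, hk, hk'⟩ := h'.crossing hR hS' (by simp [insert_insert_inter hB.disj hi hi'])
      (by rw [insert_insert_sdiff hB.disj hi hi']; exact ⟨_, hB.left⟩)
    rw [insert_insert_inter hB.disj hi hi'] at hk'
    exact ⟨_, k, hk, Or.inl (hR.pair_injective hk'.symm)⟩
  · obtain ⟨T, hT, hT'⟩ := hR.fam.exists_isTight h.mem h'.mem hS hS'
    obtain ⟨k, hk, hk'⟩ := h'.crossing hR hT (by
      rw [Finset.nonempty_iff_ne_empty]
      intro he
      have hdisj := Finset.disjoint_iff_inter_eq_empty.2 he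
      refine hT' ⟨hT.1, hT.2.congr fun u hu v hv => ?_⟩
      rw [h.of_disjoint hdisj u hu v hv, h'.of_disjoint hdisj u hu v hv]) (by
      rw [Finset.sdiff_nonempty]
      intro hsub
      have : T = ringSet c := Finset.eq_of_subset_of_card_le hsub (by rw [hT.1, hR.card_ringSet])
      exact hT' (this ▸ h.isTight hR))
    refine ⟨_, k, hk, Or.inr fun hb => hT' ?_⟩
    have := h.isTight_insert_insert hR hb
    rwa [← eq_insert_insert_of_inter hk'] at this

lemma IsRing.exists_isBridge_of_isBridge (hR : IsRing K c d O) {a b x y : Fin (m + 5)}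
    (hd : [a, b, x, y].Nodup) (hB : IsBridge c d O B a b) :
    (∃ B', IsBridge c d O B' a x) ∨ ∃ B', IsBridge c d O B' b y := by
  have hp : Function.Injective ![(0 : Fin (m + 5)), 1, 2, 3] := by
    have : [(0 : Fin (m + 5)), 1, 2, 3].Nodup := List.Nodup.sublist (by simp) (fin_nodup (m := m))
    exact List.nodup_ofFn.1 (by simpa [List.ofFn_succ] using this)
  have hq : Function.Injective ![a, b, x, y] := List.nodup_ofFn.1 (by simpa [List.ofFn_succ] using hd)
  obtain ⟨σ, Γ, h, hσ⟩ := hR.exists_isState_of_injective hp hq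
  have h0 : σ 0 = a := hσ 0
  have h1 : σ 1 = b := hσ 1
  have h2 : σ 2 = x := hσ 2
  have h3 : σ 3 = y := hσ 3
  obtain ⟨Γ', h'⟩ := hR.exists_isState (σ * Equiv.swap 1 2)
  have e12 : (1 : Fin (m + 5)) + 1 = 2 := by have := fin_add_one_add_one (0 : Fin (m+5)); simpa using this
  have e23 : (2 : Fin (m + 5)) + 1 = 3 := by have := fin_add_two_add_one (0 : Fin (m+5)); simpa using this
  have hn := fin_nodup (m := m)
  simp only [List.nodup_cons, List.mem_cons, List.not_mem_nil, not_or, or_false] at hn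
  obtain ⟨⟨n01, n02, n03, n04⟩, ⟨n12, n13, n14⟩, ⟨n23, n24⟩, n34, -⟩ := hn
  obtain ⟨B', k, hk, hk'⟩ := h.exists_isBridge hR h' (i := 0) (B := B) (by simpa [h0, h1] using hB)
  simp only [Equiv.Perm.mul_apply] at hk
  by_cases k0 : k = 0
  · subst k0
    rw [zero_add, Equiv.swap_apply_left, Equiv.swap_apply_of_ne_of_ne n01 n02, h0, h2] at hk
    exact Or.inl ⟨_, hk⟩
  have hk' := hk'.resolve_left k0
  by_cases k1 : k = 1
  · subst k1
    rw [e12, Equiv.swap_apply_left, Equiv.swap_apply_right] at hk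
    rw [e12] at hk'
    exact absurd hk.symm hk'
  by_cases k2 : k = 2
  · subst k2
    rw [e23, Equiv.swap_apply_right, Equiv.swap_apply_of_ne_of_ne (Ne.symm n13) (Ne.symm n23), h1, h3] at hk
    exact Or.inr ⟨_, hk⟩
  have k3 : k + 1 ≠ 1 := fun he => k0 (by simpa using he)
  have k4 : k + 1 ≠ 2 := fun he => k1 (by rw [← e12] at he; exact add_right_cancel he)
  rw [Equiv.swap_apply_of_ne_of_ne k1 k2, Equiv.swap_apply_of_ne_of_ne k3 k4] at hk
  exact absurd hk hk'

lemma degIn_of_two (h : ∀ v ∈ S, Γ.Adj u v ↔ v = s ∨ v = t) (hst : s ≠ t) :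
    degIn Γ S u = (if s ∈ S then 1 else 0) + if t ∈ S then 1 else 0 := by
  classical
  have : S.filter (Γ.Adj u) = ({s, t} : Finset V).filter (· ∈ S) := by
    ext v
    simp only [Finset.mem_filter, Finset.mem_insert, Finset.mem_singleton]
    constructor
    · rintro ⟨h1, h2⟩; exact ⟨(h v h1).1 h2, h1⟩
    · rintro ⟨h1, h2⟩; exact ⟨h2, (h v h2).2 h1⟩
  unfold degIn
  rw [this, Finset.filter_insert, Finset.filter_singleton]
  split_ifs <;> simp [*]

/-- The neighbours of `d o` off the cycle are `s` and `t`. -/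
structure IsFork (c d : Fin (m + 5) → V) (O : SimpleGraph V) (o : Fin (m + 5)) (s t : V) :
    Prop where
  ne : s ≠ t
  left : s ∉ ringSet c
  right : t ∉ ringSet c
  adj : ∀ v, v ∉ ringSet c → (O.Adj (d o) v ↔ v = s ∨ v = t)

namespace IsFork

lemma symm (hF : IsFork c d O o s t) : IsFork c d O o t s :=
  ⟨hF.ne.symm, hF.right, hF.left, fun v hv => by rw [hF.adj v hv, or_comm]⟩

lemma left_ne (hF : IsFork c d O o s t) : s ≠ d o := fun h =>
  O.loopless.irrefl (d o) (by rw [hF.adj _ (by rw [← h]; exact hF.left)]; exact Or.inl h.symm)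

lemma right_ne (hF : IsFork c d O o s t) : t ≠ d o := hF.symm.left_ne

lemma degIn (hF : IsFork c d O o s t) (hB : Disjoint B (ringSet c)) :
    degIn O B (d o) = (if s ∈ B then 1 else 0) + if t ∈ B then 1 else 0 :=
  degIn_of_two (fun v hv => hF.adj v (Finset.disjoint_left.1 hB hv)) hF.ne

end IsFork

lemma IsRing.exists_isFork (hR : IsRing K c d O) (o : Fin (m + 5)) : ∃ s t, IsFork c d O o s t := by
  classical
  have h1 : degIn O (ringSet c) (d o) = 1 := by
    unfold _root_.degIn
    rw [Finset.card_eq_one]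
    refine ⟨c o, ?_⟩
    ext v
    simp only [Finset.mem_filter, mem_ringSet, Finset.mem_singleton]
    constructor
    · rintro ⟨⟨i, rfl⟩, hi⟩
      rw [adj_comm, hR.init.stub _ _ (hR.notMem _), Equiv.Perm.one_apply,
        hR.stub_injective.eq_iff] at hi
      rw [hi]
    · rintro rfl
      refine ⟨⟨o, rfl⟩, ?_⟩
      rw [adj_comm, hR.init.stub _ _ (hR.notMem _), Equiv.Perm.one_apply]
  have h2 := hR.fam.reg O hR.init.mem (d o)
  rw [← Finset.union_compl (ringSet c), degIn_union disjoint_compl_right, h1] at h2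
  have h3 : ((ringSet c)ᶜ.filter (O.Adj (d o))).card = 2 := by
    have : degIn O (ringSet c)ᶜ (d o) = 2 := by omega
    unfold _root_.degIn at this
    convert this
  obtain ⟨s, t, hst, he⟩ := Finset.card_eq_two.1 h3
  have key : ∀ v, (v ∉ ringSet c ∧ O.Adj (d o) v) ↔ v = s ∨ v = t := by
    intro v
    have := congrArg (v ∈ ·) he
    simpa using this
  exact ⟨s, t, hst, ((key s).2 (Or.inl rfl)).1, ((key t).2 (Or.inr rfl)).1,
    fun v hv => by rw [← key v]; tauto⟩

lemma IsState.adj_stub (hR : IsRing K c d O) (h : IsState K c d O σ Γ) {i : Fin (m + 5)}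
    (hi : σ i = o) (hF : IsFork c d O o s t) (v : V) :
    Γ.Adj (d o) v ↔ v = c i ∨ v = s ∨ v = t := by
  by_cases hv : v ∈ ringSet c
  · obtain ⟨k, rfl⟩ := mem_ringSet.1 hv
    rw [adj_comm, h.stub _ _ (hR.notMem _), hR.stub_injective.eq_iff, ← hi, σ.injective.eq_iff,
      hR.inj.eq_iff]
    have h1 : c k ≠ s := fun he => hF.left (he ▸ hv)
    have h2 : c k ≠ t := fun he => hF.right (he ▸ hv)
    simp only [h1, h2, or_false]
    exact eq_comm
  · have : v ≠ c i := fun he => hv (he ▸ IsRing.mem_c i)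
    rw [h.off _ _ (hR.notMem _) hv, hF.adj v hv]
    simp [this]

end Exchange

section Spurs

variable {V : Type*} [Fintype V] [DecidableEq V] {m : ℕ}
  {K : SimpleGraph V → Prop} {c d : Fin (m + 5) → V} {O Γ₀ Γ Γ' : SimpleGraph V}
  {σ σ' : Equiv.Perm (Fin (m + 5))} {B S : Finset V} {u v w s t : V} {o i j k : Fin (m + 5)}

lemma fin_zero_ne_one : (0 : Fin (m + 5)) ≠ 1 := by
  have := fin_nodup (m := m)
  simp only [List.nodup_cons, List.mem_cons, not_or] at this
  exact this.1.1

lemma fin_zero_ne_two : (0 : Fin (m + 5)) ≠ 2 := by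
  have := fin_nodup (m := m)
  simp only [List.nodup_cons, List.mem_cons, not_or] at this
  exact this.1.2.1

lemma fin_one_ne_two : (1 : Fin (m + 5)) ≠ 2 := by
  have := fin_nodup (m := m)
  simp only [List.nodup_cons, List.mem_cons, not_or] at this
  exact this.2.1.1

lemma fin_one_add_one : (1 : Fin (m + 5)) + 1 = 2 := by
  have := fin_add_one_add_one (0 : Fin (m + 5)); simpa using this

lemma IsRing.exists_isState_two (hR : IsRing K c d O) (h : j ≠ k) :
    ∃ σ Γ, IsState K c d O σ Γ ∧ σ 0 = j ∧ σ 1 = k := by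
  obtain ⟨σ, Γ, hs, hσ⟩ := hR.exists_isState_of_injective (p := ![(0 : Fin (m + 5)), 1])
    (q := ![j, k])
    (List.nodup_ofFn.1 (by simp [List.ofFn_succ]))
    (List.nodup_ofFn.1 (by simpa [List.ofFn_succ] using h))
  exact ⟨σ, Γ, hs, hσ 0, hσ 1⟩

lemma IsRing.exists_isState_three (hR : IsRing K c d O) (h1 : j ≠ o) (h2 : o ≠ k) (h3 : j ≠ k) :
    ∃ σ Γ, IsState K c d O σ Γ ∧ σ 0 = j ∧ σ 1 = o ∧ σ 2 = k := by
  obtain ⟨σ, Γ, hs, hσ⟩ := hR.exists_isState_of_injective (p := ![(0 : Fin (m + 5)), 1, 2])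
    (q := ![j, o, k])
    (List.nodup_ofFn.1 (by
      simp [List.ofFn_succ, fin_zero_ne_two, fin_one_ne_two]))
    (List.nodup_ofFn.1 (by simp [List.ofFn_succ, h1, h2, h3]))
  exact ⟨σ, Γ, hs, hσ 0, hσ 1, hσ 2⟩

/-- In `Γ`, the stub of the vertex `c 1` has been inserted into the cycle, between `c 1` and `c 2`;
`s` and `t` are the new outside neighbours of `c 1` and of the inserted vertex. -/
structure IsSpur (K : SimpleGraph V → Prop) (c d : Fin (m + 5) → V) (O : SimpleGraph V)
    (σ : Equiv.Perm (Fin (m + 5))) (Γ₀ : SimpleGraph V) (s t : V) (Γ : SimpleGraph V) : Prop where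
  base : IsState K c d O σ Γ₀
  fork : IsFork c d O (σ 1) s t
  mem : K Γ
  agree : AgreeOff Γ₀ Γ (c 1) (d (σ 1))
  left : ∀ v, Γ.Adj (c 1) v ↔ v = d (σ 1) ∨ v = c 0 ∨ v = s
  right : ∀ v, Γ.Adj (d (σ 1)) v ↔ v = c 1 ∨ v = c 2 ∨ v = t

lemma IsState.exists_isSpur (hR : IsRing K c d O) (h : IsState K c d O σ Γ₀)
    (hF : IsFork c d O (σ 1) s t) :
    ∃ Γ, IsSpur K c d O σ Γ₀ s t Γ ∨ IsSpur K c d O σ Γ₀ t s Γ := by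
  have hx := h.adj_c hR 0
  have hy := h.adj_stub hR rfl hF
  simp only [zero_add] at hx
  have hc : ∀ i j, c i ≠ d j := fun i j he => hR.notMem j (by rw [← he]; exact IsRing.mem_c i)
  have hs : ∀ i, c i ≠ s := fun i he => hF.left (by rw [← he]; exact IsRing.mem_c i)
  have ht : ∀ i, c i ≠ t := fun i he => hF.right (by rw [← he]; exact IsRing.mem_c i)
  obtain ⟨Γ, hΓ, hag, hh⟩ := hR.fam.switch h.mem (x := c 1) (y := d (σ 1)) (z := d (σ 1))
    (z' := c 1) (a₁ := c 0) (a₂ := c 2) (b₁ := s) (b₂ := t) (hc _ _) (Or.inl ⟨rfl, rfl⟩)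
    (by
      simp only [List.nodup_cons, List.mem_cons, List.not_mem_nil, or_false, hs, ht,
        hF.ne, hF.left_ne.symm, hF.right_ne.symm, (hc _ _).symm, hR.inj.eq_iff, fin_zero_ne_two,
        not_false_eq_true, List.nodup_nil, and_self])
    (hc _ _) (hc _ _) (hs _).symm (ht _).symm (fun v => by rw [hx v]; tauto) hy
  rcases hh with ⟨h1, h2⟩ | ⟨h1, h2⟩
  · exact ⟨Γ, Or.inl ⟨h, hF, hΓ, hag, h1, h2⟩⟩
  · exact ⟨Γ, Or.inr ⟨h, hF.symm, hΓ, hag, h1, h2⟩⟩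

namespace IsSpur

lemma c_ne_stub (hR : IsRing K c d O) (i j : Fin (m + 5)) : c i ≠ d j :=
  fun he => hR.notMem j (by rw [← he]; exact IsRing.mem_c i)

lemma off (h : IsSpur K c d O σ Γ₀ s t Γ) (hu : u ∉ ringSet c) (hu' : u ≠ d (σ 1))
    (hv : v ∉ ringSet c) (hv' : v ≠ d (σ 1)) : Γ.Adj u v ↔ O.Adj u v := by
  rw [← h.agree u v (fun he => hu (he ▸ IsRing.mem_c 1)) hu'
    (fun he => hv (he ▸ IsRing.mem_c 1)) hv', h.base.off _ _ hu hv]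

lemma excess_off (h : IsSpur K c d O σ Γ₀ s t Γ) (hB : Disjoint B (ringSet c))
    (hB' : d (σ 1) ∉ B) : excess Γ B = excess O B :=
  excess_congr fun _ hu _ hv => h.off (Finset.disjoint_left.1 hB hu) (fun he => hB' (he ▸ hu))
    (Finset.disjoint_left.1 hB hv) (fun he => hB' (he ▸ hv))

lemma ring (hR : IsRing K c d O) (h : IsSpur K c d O σ Γ₀ s t Γ) (hi : i ≠ 1) (hj : j ≠ 1) :
    Γ.Adj (c i) (c j) ↔ j = i + 1 ∨ i = j + 1 := by
  rw [← h.agree _ _ (hR.inj.ne hi) (c_ne_stub hR _ _) (hR.inj.ne hj) (c_ne_stub hR _ _),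
    h.base.ring]

lemma stub (hR : IsRing K c d O) (h : IsSpur K c d O σ Γ₀ s t Γ) (hi : i ≠ 1)
    (hv : v ∉ ringSet c) (hv' : v ≠ d (σ 1)) : Γ.Adj (c i) v ↔ v = d (σ i) := by
  rw [← h.agree _ _ (hR.inj.ne hi) (c_ne_stub hR _ _)
    (fun he => hv (by rw [he]; exact IsRing.mem_c 1)) hv', h.base.stub _ _ hv]

lemma adj_stub (hR : IsRing K c d O) (h : IsSpur K c d O σ Γ₀ s t Γ) (hi : i ≠ 1) :
    Γ.Adj (c i) (d (σ i)) :=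
  (h.stub hR hi (hR.notMem _) (fun he => hi (σ.injective (hR.stub_injective he)))).2 rfl

end IsSpur

lemma IsBridge.degIn_left (hR : IsRing K c d O) (hB : IsBridge c d O B o j) (hoj : o ≠ j) :
    degIn O B (d o) = 1 := by
  obtain ⟨σ, Γ, h, h0, h1⟩ := hR.exists_isState_two hoj
  have hT := h.isTight_insert_insert hR (i := 0) (B := B) (by simpa [h0, h1] using hB)
  have hn : ∀ k, c k ∉ B := fun k hk => Finset.disjoint_left.1 hB.disj hk (IsRing.mem_c k)
  have hd := hR.fam.degIn_eq_two h.mem hT (v := d o) (by simp [hB.left])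
  have e : (0 : Fin (m + 5)) + 1 = 1 := by simp
  rw [e, degIn_insert (by simp [hn, hR.inj.eq_iff]), degIn_insert (hn _)] at hd
  have a0 : Γ.Adj (d o) (c 0) := by rw [adj_comm, h.stub _ _ (hR.notMem _), h0]
  have a1 : ¬ Γ.Adj (d o) (c 1) := by
    rw [adj_comm, h.stub _ _ (hR.notMem _), h1, hR.stub_injective.eq_iff]
    exact hoj
  rw [if_pos a0, if_neg a1] at hd
  rw [← degIn_congr (Γ := Γ) fun v hv => h.off _ _ (hR.notMem _) (Finset.disjoint_left.1 hB.disj hv)]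
  omega

lemma IsSpur.false_of_left (hR : IsRing K c d O) (h : IsSpur K c d O σ Γ₀ s t Γ)
    (hB : IsBridge c d O B (σ 1) (σ 0)) (hs : s ∈ B) : False := by
  have hne : σ 1 ≠ σ 0 := σ.injective.ne fin_zero_ne_one.symm
  have hd := hB.degIn_left hR hne
  have he := excess_erase (Γ := O) hB.left
  have hle := hB.excess_le
  have hn : ∀ k, c k ∉ B.erase (d (σ 1)) := fun k hk =>
    Finset.disjoint_left.1 hB.disj (Finset.mem_of_mem_erase hk) (IsRing.mem_c k)
  have hcard := Finset.card_erase_of_mem hB.left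
  have := hB.card
  refine hR.fam.false_of_insert_insert h.mem (B := B.erase (d (σ 1))) (x := c 1) (y := c 0)
    (u := s) (v := d (σ 0)) ?_ (by omega) (hn _) (hn _) ?_ ?_ ?_ ?_ ?_
  · rw [h.excess_off (hB.disj.mono_left (Finset.erase_subset _ _)) (by simp)]
    omega
  · rw [h.left]; tauto
  · exact Finset.mem_erase.2 ⟨h.fork.left_ne, hs⟩
  · exact Finset.mem_erase.2 ⟨fun e => hne (hR.stub_injective e).symm, hB.right⟩
  · rw [h.left]; tauto
  · exact h.adj_stub hR fin_zero_ne_one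

lemma IsSpur.false_of_right (hR : IsRing K c d O) (h : IsSpur K c d O σ Γ₀ s t Γ)
    (hB : IsBridge c d O B (σ 1) (σ 2)) (ht : t ∈ B) : False := by
  have hne : σ 1 ≠ σ 2 := σ.injective.ne fin_one_ne_two
  have hd := hB.degIn_left hR hne
  have he := excess_erase (Γ := O) hB.left
  have hle := hB.excess_le
  have hn : ∀ k, c k ∉ B.erase (d (σ 1)) := fun k hk =>
    Finset.disjoint_left.1 hB.disj (Finset.mem_of_mem_erase hk) (IsRing.mem_c k)
  have hcard := Finset.card_erase_of_mem hB.left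
  have := hB.card
  refine hR.fam.false_of_insert_insert h.mem (B := B.erase (d (σ 1))) (x := d (σ 1)) (y := c 2)
    (u := t) (v := d (σ 2)) ?_ (by omega) (by simp) (hn _) ?_ ?_ ?_ ?_ ?_
  · rw [h.excess_off (hB.disj.mono_left (Finset.erase_subset _ _)) (by simp)]
    omega
  · rw [h.right]; tauto
  · exact Finset.mem_erase.2 ⟨h.fork.right_ne, ht⟩
  · exact Finset.mem_erase.2 ⟨fun e => hne (hR.stub_injective e).symm, hB.right⟩
  · rw [h.right]; tauto
  · exact h.adj_stub hR fin_one_ne_two.symm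

lemma IsFork.false_of_two_isBridge (hR : IsRing K c d O) (hF : IsFork c d O o s t)
    {B' : Finset V} (hj : o ≠ j) (hk : o ≠ k) (hjk : j ≠ k) (hB : IsBridge c d O B o j)
    (hB' : IsBridge c d O B' o k) (hs : s ∈ B) (hs' : s ∈ B') : False := by
  obtain ⟨σ, Γ₀, h, rfl, rfl, rfl⟩ := hR.exists_isState_three hj.symm hk hjk
  obtain ⟨Γ, hS | hS⟩ := h.exists_isSpur hR hF
  · exact hS.false_of_left hR hB hs
  · exact hS.false_of_right hR hB' hs'

lemma IsRing.false_of_three_isBridge (hR : IsRing K c d O) {B₁ B₂ B₃ : Finset V}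
    {a j k l : Fin (m + 5)} (hd : [a, j, k, l].Nodup) (h1 : IsBridge c d O B₁ a j)
    (h2 : IsBridge c d O B₂ a k) (h3 : IsBridge c d O B₃ a l) : False := by
  simp only [List.nodup_cons, List.mem_cons, List.not_mem_nil, not_or, or_false] at hd
  obtain ⟨⟨n1, n2, n3⟩, ⟨n4, n5⟩, n6, -⟩ := hd
  obtain ⟨s, t, hF⟩ := hR.exists_isFork a
  have f1 := hF.degIn h1.disj
  have f2 := hF.degIn h2.disj
  have f3 := hF.degIn h3.disj
  rw [h1.degIn_left hR n1] at f1
  rw [h2.degIn_left hR n2] at f2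
  rw [h3.degIn_left hR n3] at f3
  have g12 := hF.false_of_two_isBridge hR n1 n2 n4 h1 h2
  have g13 := hF.false_of_two_isBridge hR n1 n3 n5 h1 h3
  have g23 := hF.false_of_two_isBridge hR n2 n3 n6 h2 h3
  have g12' := hF.symm.false_of_two_isBridge hR n1 n2 n4 h1 h2
  have g13' := hF.symm.false_of_two_isBridge hR n1 n3 n5 h1 h3
  have g23' := hF.symm.false_of_two_isBridge hR n2 n3 n6 h2 h3
  have m1 : s ∈ B₁ ∨ t ∈ B₁ := by by_contra! hn; simp [hn] at f1
  have m2 : s ∈ B₂ ∨ t ∈ B₂ := by by_contra! hn; simp [hn] at f2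
  have m3 : s ∈ B₃ ∨ t ∈ B₃ := by by_contra! hn; simp [hn] at f3
  clear f1 f2 f3
  rcases m1 with m1 | m1 <;> rcases m2 with m2 | m2 <;> rcases m3 with m3 | m3 <;>
    first
    | exact g12 m1 m2 | exact g13 m1 m3 | exact g23 m2 m3
    | exact g12' m1 m2 | exact g13' m1 m3 | exact g23' m2 m3

lemma IsRing.not_isBridge (hR : IsRing K c d O) {a b : Fin (m + 5)} (hab : a ≠ b) :
    ¬ IsBridge c d O B a b := by
  intro hB
  obtain ⟨T, hT, hTc⟩ := Finset.exists_subset_card_eq (s := ({a, b} : Finset (Fin (m + 5)))ᶜ)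
    (n := 3) (by rw [Finset.card_compl, Finset.card_pair hab, Fintype.card_fin]; omega)
  obtain ⟨x, y, z, n1, n2, n3, rfl⟩ := Finset.card_eq_three.1 hTc
  have hm : ∀ u ∈ ({x, y, z} : Finset (Fin (m + 5))), u ≠ a ∧ u ≠ b := fun u hu => by
    simpa using hT hu
  have hx := hm x (by simp)
  have hy := hm y (by simp)
  have hz := hm z (by simp)
  have hW : ∀ a b, a ≠ b → (∃ B, IsBridge c d O B a b) → ∀ u v, u ≠ v → u ≠ a → u ≠ b →
      v ≠ a → v ≠ b → (∃ B, IsBridge c d O B a u) ∨ ∃ B, IsBridge c d O B b v := by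
    rintro a b hab ⟨B, hB⟩ u v huv h1 h2 h3 h4
    exact hR.exists_isBridge_of_isBridge (by simp [hab, huv, h1.symm, h2.symm, h3.symm, h4.symm]) hB
  have h3 : ∀ a j k l, a ≠ j → a ≠ k → a ≠ l → j ≠ k → j ≠ l → k ≠ l →
      (∃ B, IsBridge c d O B a j) → (∃ B, IsBridge c d O B a k) → (∃ B, IsBridge c d O B a l) →
      False := by
    rintro a j k l n1 n2 n3 n4 n5 n6 ⟨_, h1⟩ ⟨_, h2⟩ ⟨_, h3⟩
    exact hR.false_of_three_isBridge (by simp [n1, n2, n3, n4, n5, n6]) h1 h2 h3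
  have hab' : ∃ B, IsBridge c d O B a b := ⟨B, hB⟩
  have hba' : ∃ B, IsBridge c d O B b a := ⟨B, hB.symm⟩
  have w1 := hW a b hab hab' x y n1 hx.1 hx.2 hy.1 hy.2
  have w2 := hW a b hab hab' x z n2 hx.1 hx.2 hz.1 hz.2
  have w3 := hW a b hab hab' y x n1.symm hy.1 hy.2 hx.1 hx.2
  have w4 := hW a b hab hab' y z n3 hy.1 hy.2 hz.1 hz.2
  have w5 := hW a b hab hab' z x n2.symm hz.1 hz.2 hx.1 hx.2
  have w6 := hW a b hab hab' z y n3.symm hz.1 hz.2 hy.1 hy.2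
  have a1 := h3 a b x y hab hx.1.symm hy.1.symm hx.2.symm hy.2.symm n1 hab'
  have a2 := h3 a b x z hab hx.1.symm hz.1.symm hx.2.symm hz.2.symm n2 hab'
  have a3 := h3 a b y z hab hy.1.symm hz.1.symm hy.2.symm hz.2.symm n3 hab'
  have b1 := h3 b a x y hab.symm hx.2.symm hy.2.symm hx.1.symm hy.1.symm n1 hba'
  have b2 := h3 b a x z hab.symm hx.2.symm hz.2.symm hx.1.symm hz.1.symm n2 hba'
  have b3 := h3 b a y z hab.symm hy.2.symm hz.2.symm hy.1.symm hz.1.symm n3 hba'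
  clear hW h3 hm hT hTc
  generalize (∃ B, IsBridge c d O B a x) = ax at *
  generalize (∃ B, IsBridge c d O B a y) = ay at *
  generalize (∃ B, IsBridge c d O B a z) = az at *
  generalize (∃ B, IsBridge c d O B b x) = bx at *
  generalize (∃ B, IsBridge c d O B b y) = by' at *
  generalize (∃ B, IsBridge c d O B b z) = bz at *
  grind

/-- A set off the cycle containing the stubs labelled by `J`. -/
lemma IsRing.card_le_excess' (hR : IsRing K c d O) (hB : Disjoint B (ringSet c))
    (hne : B.Nonempty) (J : Finset (Fin (m + 5))) (hJ : ∀ j ∈ J, d j ∈ B)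
    (hc : B.card + J.card ≤ m + 5) : (J.card : ℤ) ≤ excess O B := by
  rcases hc.lt_or_eq with hlt | heq
  · exact (hR.card_le_excess hB hne J hJ hc).2 hlt
  have hp := Finset.card_pos.2 hne
  by_contra hcon
  have hpos : J.card ≠ 0 := fun h0 => by
    have := hR.fam.excess_nonneg hR.init.mem (S := B) (by omega)
    omega
  obtain ⟨σ, Γ, h, hσ⟩ := hR.exists_isState_of_injective
    (p := Fin.castLE (by omega : J.card ≤ m + 5)) (q := fun k => (J.equivFin.symm k : Fin (m + 5)))
    (Fin.castLE_injective _) (Subtype.val_injective.comp (Equiv.injective _))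
  obtain ⟨h1, h2⟩ := excess_union_le hR h hB J.card (by omega) (fun i hi => by
    have := hσ ⟨i, hi⟩
    rw [show Fin.castLE (by omega : J.card ≤ m + 5) ⟨i, hi⟩ = i from rfl] at this
    rw [this]
    exact hJ _ (Subtype.property _))
  rw [if_neg hpos] at h2
  have hT := hR.fam.isTight h.mem (h1.trans heq) (by omega)
  obtain ⟨i, hi, -⟩ := h.crossing hR hT ⟨c 0, Finset.mem_inter.2
    ⟨Finset.mem_union_right _ (Finset.mem_image_of_mem _ (Finset.mem_filter.2
      ⟨Finset.mem_univ _, by simpa using Nat.pos_of_ne_zero hpos⟩)), IsRing.mem_c 0⟩⟩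
    (by
      obtain ⟨b, hb⟩ := hne
      exact ⟨b, Finset.mem_sdiff.2 ⟨Finset.mem_union_left _ hb, Finset.disjoint_left.1 hB hb⟩⟩)
  exact hR.not_isBridge (σ.injective.ne (fin_succ_ne i).symm) hi

end Spurs

section Connections

variable {V : Type*} [Fintype V] [DecidableEq V] {m : ℕ}
  {K : SimpleGraph V → Prop} {c d : Fin (m + 5) → V} {O Γ₀ Γ Γ' : SimpleGraph V}
  {σ σ' : Equiv.Perm (Fin (m + 5))} {B S : Finset V} {u v w s t : V} {o i j k : Fin (m + 5)}

/-- The cycle together with the stub `d o`. -/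
def spurSet (c d : Fin (m + 5) → V) (o : Fin (m + 5)) : Finset V := insert (d o) (ringSet c)

/-- Attaching `B` to two consecutive cycle vertices with outside neighbours `s` and `d j` gives a
core on `m + 5` vertices. -/
structure IsConn (c d : Fin (m + 5) → V) (O : SimpleGraph V) (o : Fin (m + 5)) (s : V)
    (j : Fin (m + 5)) (B : Finset V) : Prop where
  disj : Disjoint B (spurSet c d o)
  card : B.card + 2 = m + 5
  left : s ∈ B
  right : d j ∈ B
  excess_le : excess O B ≤ 1
  degIn_le : degIn O B s ≤ 1

lemma mem_spurSet : v ∈ spurSet c d o ↔ v = d o ∨ v ∈ ringSet c := by simp [spurSet]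

lemma c_mem_spurSet (i : Fin (m + 5)) : c i ∈ spurSet c d o := mem_spurSet.2 (Or.inr (IsRing.mem_c i))

lemma disjoint_spurSet : Disjoint B (spurSet c d o) ↔ d o ∉ B ∧ Disjoint B (ringSet c) := by
  simp [spurSet]

lemma IsConn.disj' (h : IsConn c d O o s j B) : Disjoint B (ringSet c) :=
  (disjoint_spurSet.1 h.disj).2

lemma IsConn.notMem (h : IsConn c d O o s j B) : d o ∉ B := (disjoint_spurSet.1 h.disj).1

lemma IsRing.card_spurSet (hR : IsRing K c d O) : (spurSet c d o).card = m + 6 := by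
  rw [spurSet, Finset.card_insert_of_notMem (hR.notMem _), hR.card_ringSet]

lemma IsFork.left_notMem (hF : IsFork c d O o s t) : s ∉ spurSet c d o := by
  rw [mem_spurSet, not_or]
  exact ⟨hF.left_ne, hF.left⟩

namespace IsSpur

lemma off_spurSet (h : IsSpur K c d O σ Γ₀ s t Γ) (hB : Disjoint B (spurSet c d (σ 1))) :
    ∀ u ∈ B, ∀ v ∈ B, (Γ.Adj u v ↔ O.Adj u v) := by
  intro u hu v hv
  have h1 := Finset.disjoint_left.1 hB hu
  have h2 := Finset.disjoint_left.1 hB hv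
  rw [mem_spurSet, not_or] at h1 h2
  exact h.off h1.2 h1.1 h2.2 h2.1

lemma isTight_left (hR : IsRing K c d O) (h : IsSpur K c d O σ Γ₀ s t Γ)
    (hB : IsConn c d O (σ 1) s (σ 0) B) : IsTight Γ (m + 5) (insert (c 1) (insert (c 0) B)) := by
  have hn : ∀ k, c k ∉ B := fun k hk => Finset.disjoint_left.1 hB.disj hk (c_mem_spurSet k)
  have hadj : Γ.Adj (c 1) (c 0) := by rw [h.left]; tauto
  have h1 : Γ.Adj (c 1) s := by rw [h.left]; tauto
  refine hR.fam.isTight h.mem ?_ ?_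
  · rw [card_insert_insert (hn _) (hn _) hadj.ne, hB.card]
  · have := excess_insert_insert_le (hn _) (hn _) hadj (one_le_degIn hB.left h1)
      (one_le_degIn hB.right (h.adj_stub hR fin_zero_ne_one))
    have := h.excess_off hB.disj' hB.notMem
    have := hB.excess_le
    omega

lemma isTight_right (hR : IsRing K c d O) (h : IsSpur K c d O σ Γ₀ s t Γ)
    (hB : IsConn c d O (σ 1) t (σ 2) B) :
    IsTight Γ (m + 5) (insert (d (σ 1)) (insert (c 2) B)) := by
  have hn : ∀ k, c k ∉ B := fun k hk => Finset.disjoint_left.1 hB.disj hk (c_mem_spurSet k)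
  have hadj : Γ.Adj (d (σ 1)) (c 2) := by rw [h.right]; tauto
  have h1 : Γ.Adj (d (σ 1)) t := by rw [h.right]; tauto
  refine hR.fam.isTight h.mem ?_ ?_
  · rw [card_insert_insert hB.notMem (hn _) hadj.ne, hB.card]
  · have := excess_insert_insert_le hB.notMem (hn _) hadj (one_le_degIn hB.left h1)
      (one_le_degIn hB.right (h.adj_stub hR fin_one_ne_two.symm))
    have := h.excess_off hB.disj' hB.notMem
    have := hB.excess_le
    omega

/-- The unique outside neighbour of a vertex of the enlarged cycle. -/
lemma exists_stub (hR : IsRing K c d O) (h : IsSpur K c d O σ Γ₀ s t Γ) :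
    ∃ st : V → V, st (d (σ 1)) = t ∧ st (c 1) = s ∧ (∀ i, i ≠ 1 → st (c i) = d (σ i)) ∧
      ∀ r ∈ spurSet c d (σ 1), st r ∉ spurSet c d (σ 1) ∧
        ∀ v ∉ spurSet c d (σ 1), Γ.Adj r v ↔ v = st r := by
  have hcd := c_ne_stub hR
  let st : V → V := fun r =>
    if r = d (σ 1) then t else if r = c 1 then s else Function.extend c (fun i => d (σ i)) id r
  have h1 : st (d (σ 1)) = t := if_pos rfl
  have h2 : st (c 1) = s := by simp [st, hcd]
  have h3 : ∀ i, i ≠ 1 → st (c i) = d (σ i) := fun i hi => by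
    have : c i ≠ c 1 := hR.inj.ne hi
    simp only [st, hcd, this, if_false]
    exact hR.inj.extend_apply _ _ i
  refine ⟨st, h1, h2, h3, fun r hr => ?_⟩
  rcases mem_spurSet.1 hr with rfl | hr
  · rw [h1]
    refine ⟨h.fork.symm.left_notMem, fun v hv => ?_⟩
    rw [h.right]
    have e1 : v ≠ c 1 := fun he => hv (he ▸ c_mem_spurSet 1)
    have e2 : v ≠ c 2 := fun he => hv (he ▸ c_mem_spurSet 2)
    simp [e1, e2]
  · obtain ⟨i, rfl⟩ := mem_ringSet.1 hr
    by_cases hi : i = 1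
    · subst hi
      rw [h2]
      refine ⟨h.fork.left_notMem, fun v hv => ?_⟩
      rw [h.left]
      have e1 : v ≠ c 0 := fun he => hv (he ▸ c_mem_spurSet 0)
      have e2 : v ≠ d (σ 1) := fun he => hv (mem_spurSet.2 (Or.inl he))
      simp [e1, e2]
    · rw [h3 i hi]
      refine ⟨?_, fun v hv => ?_⟩
      · rw [mem_spurSet, not_or]
        exact ⟨fun he => hi (σ.injective (hR.stub_injective he)), hR.notMem _⟩
      · rw [mem_spurSet, not_or] at hv
        exact h.stub hR hi hv.2 hv.1

lemma sdiff_nonempty (hR : IsRing K c d O) (h : IsSpur K c d O σ Γ₀ s t Γ)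
    (hS : IsTight Γ (m + 5) S) : (S \ spurSet c d (σ 1)).Nonempty := by
  rw [Finset.sdiff_nonempty]
  intro hsub
  obtain ⟨st, -, -, -, hst⟩ := h.exists_stub hR
  have hdeg : ∀ y ∈ spurSet c d (σ 1), degIn Γ (spurSet c d (σ 1)) y ≤ 2 := by
    intro y hy
    obtain ⟨h1, h2⟩ := hst y hy
    have h3 := degIn_mono (Γ := Γ) (v := y)
      (Finset.subset_univ (insert (st y) (spurSet c d (σ 1))))
    rw [degIn_insert h1, if_pos ((h2 _ h1).2 rfl), hR.fam.reg _ h.mem] at h3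
    omega
  have hnb : ∀ r ∈ spurSet c d (σ 1), ∃ y ∈ spurSet c d (σ 1), Γ.Adj y r := by
    intro r hr
    rcases mem_spurSet.1 hr with rfl | hr
    · exact ⟨c 1, c_mem_spurSet 1, by rw [h.left]; tauto⟩
    · obtain ⟨i, rfl⟩ := mem_ringSet.1 hr
      by_cases h1 : i = 1
      · exact ⟨d (σ 1), by simp [spurSet], by rw [h.right, h1]; tauto⟩
      by_cases h0 : i = 0
      · exact ⟨c 1, c_mem_spurSet 1, by rw [h.left, h0]; tauto⟩
      · exact ⟨c (i + 1), c_mem_spurSet _, by rw [h.ring hR (by simpa using h0) h1]; tauto⟩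
  obtain ⟨r, hr, hrS⟩ : ∃ r ∈ spurSet c d (σ 1), r ∉ S := by
    by_contra! hcon
    have := Finset.card_le_card (show spurSet c d (σ 1) ⊆ S from hcon)
    rw [hR.card_spurSet, hS.1] at this
    omega
  have hSe : S = (spurSet c d (σ 1)).erase r := by
    refine Finset.eq_of_subset_of_card_le (fun x hx => Finset.mem_erase.2
      ⟨fun he => hrS (he ▸ hx), hsub hx⟩) ?_
    rw [Finset.card_erase_of_mem hr, hR.card_spurSet, hS.1]
    omega
  obtain ⟨y, hy, hyr⟩ := hnb r hr
  have hyS : y ∈ S := by rw [hSe]; exact Finset.mem_erase.2 ⟨hyr.ne, hy⟩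
  have h1 := hS.2.2 y hyS
  have h2 := hdeg y hy
  rw [← Finset.insert_erase hr, degIn_insert (Finset.notMem_erase _ _), if_pos hyr, ← hSe] at h2
  omega

lemma card_filter_le_excess (hR : IsRing K c d O) (h : IsSpur K c d O σ Γ₀ s t Γ)
    (hS : IsTight Γ (m + 5) S) {st : V → V} (h1 : st (d (σ 1)) = t) (h2 : st (c 1) = s)
    (h3 : ∀ i, i ≠ 1 → st (c i) = d (σ i)) :
    let R := spurSet c d (σ 1)
    let F := (S ∩ R).filter (st · ∈ S \ R)
    (F.card : ℤ) ≤ excess Γ (S \ R) + 1 ∧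
      (F.card < (S ∩ R).card → (F.card : ℤ) ≤ excess Γ (S \ R)) := by
  intro R F
  set B := S \ R with hB
  have hdisj : Disjoint B R := Finset.sdiff_disjoint
  obtain ⟨hdo, hdisj'⟩ := disjoint_spurSet.1 hdisj
  have hne : B.Nonempty := h.sdiff_nonempty hR hS
  have hcard := Finset.card_inter_add_card_sdiff S R
  rw [hS.1, ← hB] at hcard
  have hFle : F.card ≤ (S ∩ R).card := Finset.card_filter_le _ _
  rw [h.excess_off hdisj' hdo]
  let I : Finset (Fin (m + 5)) :=
    Finset.univ.filter fun i => i ≠ 1 ∧ c i ∈ S ∧ d (σ i) ∈ B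
  have hI : (F.erase (d (σ 1))).erase (c 1) = I.image c := by
    ext x
    simp only [F, R, Finset.mem_erase, Finset.mem_filter, Finset.mem_inter, Finset.mem_image, I,
      Finset.mem_univ, true_and, mem_spurSet, mem_ringSet]
    constructor
    · rintro ⟨n1, n2, ⟨h4, h5 | ⟨i, rfl⟩⟩, h6⟩
      · exact absurd h5 n2
      · have hi : i ≠ 1 := fun he => n1 (by rw [he])
        exact ⟨i, ⟨hi, h4, by rw [← h3 i hi]; exact h6⟩, rfl⟩
    · rintro ⟨i, ⟨hi, h4, h5⟩, rfl⟩
      exact ⟨hR.inj.ne hi, c_ne_stub hR _ _, ⟨h4, Or.inr ⟨i, rfl⟩⟩, by rw [h3 i hi]; exact h5⟩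
  have hFc : F.card = I.card + (if c 1 ∈ F then 1 else 0) + if d (σ 1) ∈ F then 1 else 0 := by
    rw [← Finset.card_image_of_injective _ hR.inj, ← hI]
    have hc1 : c 1 ∈ F.erase (d (σ 1)) ↔ c 1 ∈ F := by simp [c_ne_stub hR]
    have e1 := Finset.card_erase_add_one (s := F) (a := d (σ 1))
    have e2 := Finset.card_erase_add_one (s := F.erase (d (σ 1))) (a := c 1)
    have e3 := Finset.erase_eq_of_notMem (s := F) (a := d (σ 1))
    have e4 := Finset.erase_eq_of_notMem (s := F.erase (d (σ 1))) (a := c 1)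
    rw [hc1] at e2 e4
    split_ifs with q1 q2 q2
    · rw [← e1 q2, ← e2 q1]
    · rw [e3 q2] at e2 ⊢
      rw [← e2 q1]
    · rw [← e1 q2, e4 q1]
    · rw [e4 q1, e3 q2]; rfl
  set J := I.image σ with hJ
  have hJc : J.card = I.card := Finset.card_image_of_injective _ σ.injective
  have hJB : ∀ j ∈ J, d j ∈ B := by
    intro j hj
    obtain ⟨i, hi, rfl⟩ := Finset.mem_image.1 hj
    exact (Finset.mem_filter.1 hi).2.2.2
  have hoJ : σ 1 ∉ J := by
    intro hj
    obtain ⟨i, hi, he⟩ := Finset.mem_image.1 hj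
    exact (Finset.mem_filter.1 hi).2.1 (σ.injective he)
  have hdo' : Disjoint (insert (d (σ 1)) B) (ringSet c) := by
    rw [Finset.disjoint_insert_left]; exact ⟨hR.notMem _, hdisj'⟩
  have hex := excess_insert (Γ := O) hdo
  rw [h.fork.degIn hdisj'] at hex
  have hcB := Finset.card_insert_of_notMem hdo
  have hcJ := Finset.card_insert_of_notMem hoJ
  have z0 := hR.card_le_excess' hdisj' hne J hJB
  have z1 := hR.card_le_excess' hdo' (by simp) J fun j hj => Finset.mem_insert_of_mem (hJB j hj)
  have z2 := hR.card_le_excess' hdo' (by simp) (insert (σ 1) J) (by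
    intro j hj
    rcases Finset.mem_insert.1 hj with rfl | hj
    · simp
    · exact Finset.mem_insert_of_mem (hJB j hj))
  rw [hcB] at z1 z2
  rw [hcJ] at z2
  have hs : c 1 ∈ F → s ∈ B := fun hf => by
    have := (Finset.mem_filter.1 hf).2
    rwa [h2] at this
  have ht : d (σ 1) ∈ F → t ∈ B := fun hf => by
    have := (Finset.mem_filter.1 hf).2
    rwa [h1] at this
  by_cases q1 : c 1 ∈ F <;> by_cases q2 : d (σ 1) ∈ F
  · rw [if_pos (hs q1), if_pos (ht q2)] at hex
    rw [if_pos q1, if_pos q2] at hFc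
    omega
  · rw [if_pos (hs q1)] at hex
    rw [if_pos q1, if_neg q2] at hFc
    split_ifs at hex <;> omega
  · rw [if_pos (ht q2)] at hex
    rw [if_neg q1, if_pos q2] at hFc
    split_ifs at hex <;> omega
  · rw [if_neg q1, if_neg q2] at hFc
    omega

lemma crossing (hR : IsRing K c d O) (h : IsSpur K c d O σ Γ₀ s t Γ)
    (hS : IsTight Γ (m + 5) S) (hA : (S ∩ spurSet c d (σ 1)).Nonempty) :
    (S ∩ spurSet c d (σ 1) = {c 1, c 0} ∧
        IsConn c d O (σ 1) s (σ 0) (S \ spurSet c d (σ 1))) ∨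
      (S ∩ spurSet c d (σ 1) = {d (σ 1), c 2} ∧
        IsConn c d O (σ 1) t (σ 2) (S \ spurSet c d (σ 1))) := by
  obtain ⟨st, h1, h2, h3, hst⟩ := h.exists_stub hR
  obtain ⟨k1, k2⟩ := h.card_filter_le_excess hR hS h1 h2 h3
  obtain ⟨a, a', hAeq, hadj, ha, ha', hBc, hBe⟩ := hR.fam.crossing h.mem st
    (fun r hr => (hst r hr).2) hS hA (h.sdiff_nonempty hR hS) k1 k2
  clear k1 k2
  set B := S \ spurSet c d (σ 1) with hB
  have hdisj : Disjoint B (spurSet c d (σ 1)) := Finset.sdiff_disjoint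
  obtain ⟨hdo, hdisj'⟩ := disjoint_spurSet.1 hdisj
  rw [h.excess_off hdisj' hdo] at hBe
  have hcn : ∀ i, c i ∉ B := fun i hi => Finset.disjoint_left.1 hdisj hi (c_mem_spurSet i)
  have hdeg : ∀ r ∈ S ∩ spurSet c d (σ 1), ∀ v ∈ B, Γ.Adj r v → degIn O B v ≤ 1 := by
    intro r hr v hv hrv
    have hrB : r ∉ B := fun hrB => Finset.disjoint_left.1 hdisj hrB (Finset.mem_inter.1 hr).2
    have e1 := hR.fam.degIn_eq_two h.mem hS (Finset.sdiff_subset hv)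
    have e2 := degIn_mono (Γ := Γ) (v := v) (S := insert r B) (T := S)
      (Finset.insert_subset (Finset.mem_inter.1 hr).1 Finset.sdiff_subset)
    rw [degIn_insert hrB, if_pos hrv.symm, e1] at e2
    rw [← degIn_congr (h.off_spurSet hdisj v hv)]
    omega
  have hs : Γ.Adj (c 1) s := by rw [h.left]; tauto
  have ht : Γ.Adj (d (σ 1)) t := by rw [h.right]; tauto
  have key1 : ∀ a', S ∩ spurSet c d (σ 1) = {c 1, a'} → Γ.Adj (c 1) a' → st (c 1) ∈ B →
      st a' ∈ B → a' = c 0 ∧ IsConn c d O (σ 1) s (σ 0) B := by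
    intro a' hAeq hadj ha ha'
    rw [h2] at ha
    have hm : a' ∈ S ∩ spurSet c d (σ 1) := by simp [hAeq]
    rcases (h.left a').1 hadj with rfl | rfl | rfl
    · rw [h1] at ha'
      have hex := excess_insert (Γ := O) hdo
      rw [h.fork.degIn hdisj', if_pos ha, if_pos ha', hBe] at hex
      have := hR.fam.one_le_excess hR.init.mem (S := insert (d (σ 1)) B) (by simp)
        (by rw [Finset.card_insert_of_notMem hdo]; omega)
      omega
    · rw [h3 0 fin_zero_ne_one] at ha'
      exact ⟨rfl, hdisj, hBc, ha, ha', hBe.le, hdeg (c 1) (by simp [hAeq]) s ha hs⟩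
    · exact absurd (Finset.mem_inter.1 hm).2 h.fork.left_notMem
  have key2 : ∀ i, i ≠ 1 → S ∩ spurSet c d (σ 1) = {d (σ 1), c i} → Γ.Adj (d (σ 1)) (c i) →
      st (d (σ 1)) ∈ B → st (c i) ∈ B → i = 2 ∧ IsConn c d O (σ 1) t (σ 2) B := by
    intro i hi hAeq hadj ha ha'
    rw [h1] at ha
    rw [h3 i hi] at ha'
    rcases (h.right _).1 hadj with he | he | he
    · exact absurd (hR.inj he) hi
    · have := hR.inj he
      subst this
      exact ⟨rfl, hdisj, hBc, ha, ha', hBe.le, hdeg (d (σ 1)) (by simp [hAeq]) t ha ht⟩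
    · exact absurd (he ▸ IsRing.mem_c i) h.fork.right
  have htri : ∀ a ∈ S ∩ spurSet c d (σ 1), a = c 1 ∨ a = d (σ 1) ∨ ∃ i, i ≠ 1 ∧ a = c i := by
    intro a ha
    rcases mem_spurSet.1 (Finset.mem_inter.1 ha).2 with rfl | ha
    · tauto
    · obtain ⟨i, rfl⟩ := mem_ringSet.1 ha
      by_cases hi : i = 1
      · rw [hi]; tauto
      · exact Or.inr (Or.inr ⟨i, hi, rfl⟩)
  have hAeq' := hAeq.trans (Finset.pair_comm a a')
  rcases htri a (by simp [hAeq]) with rfl | ha1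
  · obtain ⟨rfl, hc⟩ := key1 _ hAeq hadj ha ha'
    exact Or.inl ⟨hAeq, hc⟩
  rcases htri a' (by simp [hAeq]) with rfl | ha1'
  · obtain ⟨rfl, hc⟩ := key1 _ hAeq' hadj.symm ha' ha
    exact Or.inl ⟨hAeq', hc⟩
  rcases ha1 with rfl | ⟨i, hi, rfl⟩ <;> rcases ha1' with rfl | ⟨i', hi', rfl⟩
  · exact absurd rfl hadj.ne
  · obtain ⟨rfl, hc⟩ := key2 _ hi' hAeq hadj ha ha'
    exact Or.inr ⟨hAeq, hc⟩
  · obtain ⟨rfl, hc⟩ := key2 _ hi hAeq' hadj.symm ha' ha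
    exact Or.inr ⟨hAeq', hc⟩
  · rw [h3 i hi] at ha
    rw [h3 i' hi'] at ha'
    exact absurd ⟨hdisj', hBc, ha, ha', hBe.le⟩ (hR.not_isBridge
      (σ.injective.ne (fun he => hadj.ne (by rw [he]))))

end IsSpur

end Connections

section Elimination

variable {V : Type*} [Fintype V] [DecidableEq V] {m : ℕ}
  {K : SimpleGraph V → Prop} {c d : Fin (m + 5) → V} {O Γ₀ Γ₀' Γ Γ' : SimpleGraph V}
  {σ σ' : Equiv.Perm (Fin (m + 5))} {B B' S : Finset V} {u v w s t s₁ s₂ : V}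
  {o i j k l : Fin (m + 5)}

lemma IsSpur.exists_isConn (hR : IsRing K c d O) (h : IsSpur K c d O σ Γ₀ s t Γ) :
    (∃ B, IsConn c d O (σ 1) s (σ 0) B) ∨ ∃ B, IsConn c d O (σ 1) t (σ 2) B := by
  have hC : ¬ IsTight Γ (m + 5) (ringSet c) := by
    intro hT
    have h2 := hR.fam.degIn_eq_two h.mem hT (IsRing.mem_c 1)
    rw [degIn_of_two (s := c 0) (t := s) _ _, if_pos (IsRing.mem_c 0), if_neg h.fork.left] at h2
    · omega
    · intro v hv
      have : v ≠ d (σ 1) := fun he => hR.notMem _ (he ▸ hv)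
      rw [h.left]
      simp [this]
    · intro he
      exact h.fork.left (he ▸ IsRing.mem_c 0)
  obtain ⟨T, hT, hT'⟩ := hR.fam.exists_isTight h.base.mem h.mem (h.base.isTight hR) hC
  have hA : (T ∩ spurSet c d (σ 1)).Nonempty := by
    rw [Finset.nonempty_iff_ne_empty]
    intro he
    have hdisj := Finset.disjoint_iff_inter_eq_empty.2 he
    refine hT' ⟨hT.1, hT.2.congr fun u hu v hv => ?_⟩
    rw [h.off_spurSet hdisj u hu v hv, h.base.of_disjoint (disjoint_spurSet.1 hdisj).2 u hu v hv]
  rcases h.crossing hR hT hA with ⟨-, hc⟩ | ⟨-, hc⟩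
  · exact Or.inl ⟨_, hc⟩
  · exact Or.inr ⟨_, hc⟩

lemma IsSpur.inter_nonempty_of_not_isTight (h : IsSpur K c d O σ Γ₀ s t Γ)
    (h' : IsSpur K c d O σ' Γ₀' s t Γ') (h1 : σ 1 = σ' 1) (hS : IsTight Γ' (m + 5) S)
    (hS' : ¬ IsTight Γ (m + 5) S) : (S ∩ spurSet c d (σ' 1)).Nonempty := by
  rw [Finset.nonempty_iff_ne_empty]
  intro he
  have hdisj := Finset.disjoint_iff_inter_eq_empty.2 he
  refine hS' ⟨hS.1, hS.2.congr fun u hu v hv => ?_⟩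
  rw [h'.off_spurSet hdisj u hu v hv, h.off_spurSet (h1 ▸ hdisj) u hu v hv]

lemma IsSpur.exists_isConn_right (hR : IsRing K c d O) (h : IsSpur K c d O σ Γ₀ s t Γ)
    (h' : IsSpur K c d O σ' Γ₀' s t Γ') (h1 : σ 1 = σ' 1) (h0 : σ 0 = σ' 0)
    (hB : IsConn c d O (σ 1) t (σ 2) B) : ∃ B', IsConn c d O (σ' 1) t (σ' 2) B' := by
  have hS := h.isTight_right hR hB
  have hm1 : d (σ 1) ∈ spurSet c d (σ' 1) := by simp [spurSet, h1]
  have hdisj : Disjoint B (spurSet c d (σ' 1)) := h1 ▸ hB.disj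
  have hint := insert_insert_inter hdisj hm1 (c_mem_spurSet 2)
  by_cases hS' : IsTight Γ' (m + 5) (insert (d (σ 1)) (insert (c 2) B))
  · rcases h'.crossing hR hS' (by simp [hint]) with ⟨he, -⟩ | ⟨-, hc⟩
    · rw [hint] at he
      have : d (σ 1) ∈ ({c 1, c 0} : Finset V) := by simp [← he]
      simp [(IsSpur.c_ne_stub hR _ _).symm] at this
    · exact ⟨_, hc⟩
  · obtain ⟨T, hT, hT'⟩ := hR.fam.exists_isTight h.mem h'.mem hS hS'
    rcases h'.crossing hR hT (h.inter_nonempty_of_not_isTight h' h1 hT hT') with ⟨he, hc⟩ | ⟨-, hc⟩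
    · refine absurd ?_ hT'
      rw [eq_insert_insert_of_inter he]
      exact h.isTight_left hR (by rw [h1, h0]; exact hc)
    · exact ⟨_, hc⟩

lemma IsSpur.exists_isConn_left (hR : IsRing K c d O) (h : IsSpur K c d O σ Γ₀ s t Γ)
    (h' : IsSpur K c d O σ' Γ₀' s t Γ') (h1 : σ 1 = σ' 1) (h2 : σ 2 = σ' 2)
    (hB : IsConn c d O (σ 1) s (σ 0) B) : ∃ B', IsConn c d O (σ' 1) s (σ' 0) B' := by
  have hS := h.isTight_left hR hB
  have hdisj : Disjoint B (spurSet c d (σ' 1)) := h1 ▸ hB.disj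
  have hint := insert_insert_inter hdisj (c_mem_spurSet 1) (c_mem_spurSet 0)
  by_cases hS' : IsTight Γ' (m + 5) (insert (c 1) (insert (c 0) B))
  · rcases h'.crossing hR hS' (by simp [hint]) with ⟨-, hc⟩ | ⟨he, -⟩
    · exact ⟨_, hc⟩
    · rw [hint] at he
      have : d (σ' 1) ∈ ({c 1, c 0} : Finset V) := by simp [he]
      simp [(IsSpur.c_ne_stub hR _ _).symm] at this
  · obtain ⟨T, hT, hT'⟩ := hR.fam.exists_isTight h.mem h'.mem hS hS'
    rcases h'.crossing hR hT (h.inter_nonempty_of_not_isTight h' h1 hT hT') with ⟨-, hc⟩ | ⟨he, hc⟩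
    · exact ⟨_, hc⟩
    · refine absurd ?_ hT'
      rw [eq_insert_insert_of_inter he, ← h1]
      refine h.isTight_right hR (by rw [h1, h2]; exact hc)

lemma IsConn.ne_stub (hR : IsRing K c d O) (hB : IsConn c d O o s j B)
    (hB' : IsConn c d O o s k B') (hjk : j ≠ k) (a : Fin (m + 5)) : s ≠ d a := by
  rintro rfl
  have key : ∀ j B, IsConn c d O o (d a) j B → a = j := by
    intro j B hB
    by_contra hne
    have hc := Finset.card_pair hne
    have := hR.card_le_excess' hB.disj' ⟨_, hB.left⟩ {a, j} (by simp [hB.left, hB.right])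
      (by rw [hc]; exact hB.card.le)
    have := hB.excess_le
    omega
  exact hjk ((key j B hB).symm.trans (key k B' hB'))

lemma IsFork.exists_adj (hR : IsRing K c d O) (hF : IsFork c d O o s t) (hs : ∀ a, s ≠ d a) :
    ∃ s₁ s₂, [d o, s₁, s₂].Nodup ∧ s₁ ∉ ringSet c ∧ s₂ ∉ ringSet c ∧
      ∀ v, O.Adj s v ↔ v = d o ∨ v = s₁ ∨ v = s₂ := by
  classical
  have h0 : O.Adj s (d o) := by rw [adj_comm, hF.adj _ hF.left]; exact Or.inl rfl
  have h3 := hR.fam.reg O hR.init.mem s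
  rw [← Finset.insert_erase (Finset.mem_univ (d o)), degIn_insert (Finset.notMem_erase _ _),
    if_pos h0] at h3
  have h2 : ((Finset.univ.erase (d o)).filter (O.Adj s)).card = 2 := by
    have : _root_.degIn O (Finset.univ.erase (d o)) s = 2 := by omega
    unfold _root_.degIn at this
    convert this
  obtain ⟨s₁, s₂, hne, he⟩ := Finset.card_eq_two.1 h2
  have key : ∀ v, (v ≠ d o ∧ O.Adj s v) ↔ v = s₁ ∨ v = s₂ := by
    intro v
    have := congrArg (v ∈ ·) he
    simpa using this
  obtain ⟨h1o, h1⟩ := (key s₁).2 (Or.inl rfl)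
  obtain ⟨h2o, h2⟩ := (key s₂).2 (Or.inr rfl)
  have hoff : ∀ v, O.Adj s v → v ∉ ringSet c := by
    intro v hv hvc
    obtain ⟨i, rfl⟩ := mem_ringSet.1 hvc
    exact hs _ ((hR.init.stub i s hF.left).1 hv.symm)
  refine ⟨s₁, s₂, by simp [h1o.symm, h2o.symm, hne], hoff _ h1, hoff _ h2, fun v => ?_⟩
  rw [← key v]
  by_cases hv : v = d o
  · simp [hv, h0]
  · simp [hv]

lemma IsConn.excess_erase_le (hB : IsConn c d O o s j B) : excess O (B.erase s) ≤ 1 := by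
  have h1 := hB.excess_le
  have h2 := hB.degIn_le
  rw [excess_erase hB.left]
  omega

lemma IsConn.exists_adj (hR : IsRing K c d O) (hB : IsConn c d O o s j B) (hs : s ≠ d j) :
    ∃ u ∈ B, O.Adj s u := by
  rw [← degIn_pos_iff]
  by_contra hcon
  have h1 := excess_erase (Γ := O) hB.left
  have h2 := hB.excess_le
  have h3 := Finset.card_erase_of_mem hB.left
  have h4 := hB.card
  have := hR.fam.one_le_excess hR.init.mem (S := B.erase s)
    ⟨d j, Finset.mem_erase.2 ⟨hs.symm, hB.right⟩⟩ (by omega)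
  omega

lemma IsFork.false_of_two_isConn (hR : IsRing K c d O) (hF : IsFork c d O o s t)
    (hj : j ≠ o) (hk : k ≠ o) (hjk : j ≠ k) (hB : IsConn c d O o s j B)
    (hB' : IsConn c d O o s k B') (hn : [d o, s₁, s₂].Nodup) (hs₁ : s₁ ∉ ringSet c)
    (hs₂ : s₂ ∉ ringSet c) (hadj : ∀ v, O.Adj s v ↔ v = d o ∨ v = s₁ ∨ v = s₂)
    (h1 : s₁ ∈ B) (h1' : s₁ ∈ B') : False := by
  have hs := hB.ne_stub hR hB' hjk
  obtain ⟨σ, Γ₀, h, rfl, rfl, rfl⟩ := hR.exists_isState_three hj hk.symm hjk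
  have hcd := IsSpur.c_ne_stub hR
  have hc : ∀ i v, v ∉ ringSet c → c i ≠ v := fun i v hv he => hv (he ▸ IsRing.mem_c i)
  have hx := h.adj_c hR 0
  simp only [zero_add] at hx
  have hy : ∀ v, Γ₀.Adj s v ↔ v = d (σ 1) ∨ v = s₁ ∨ v = s₂ := by
    intro v
    by_cases hv : v ∈ ringSet c
    · obtain ⟨i, rfl⟩ := mem_ringSet.1 hv
      rw [adj_comm, h.stub _ _ hF.left]
      simp [hs, hcd, hc i s₁ hs₁, hc i s₂ hs₂]
    · rw [h.off _ _ hF.left hv, hadj]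
  simp only [List.nodup_cons, List.mem_cons, List.not_mem_nil, not_or, or_false,
    List.nodup_nil, and_true, not_false_eq_true] at hn
  obtain ⟨Γ, hΓ, hag, hh⟩ := hR.fam.switch h.mem (x := c 1) (y := s) (z := d (σ 1))
    (z' := d (σ 1)) (a₁ := c 0) (a₂ := c 2) (b₁ := s₁) (b₂ := s₂) (hc _ _ hF.left)
    (Or.inr ⟨rfl, (hcd _ _).symm, hF.left_ne.symm⟩)
    (by
      simp only [List.nodup_cons, List.mem_cons, List.not_mem_nil, or_false, hc _ _ hs₁,
        hc _ _ hs₂, hn, (hcd _ _).symm, hR.inj.eq_iff, fin_zero_ne_two,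
        not_false_eq_true, List.nodup_nil, and_self])
    (hc _ _ hF.left) (hc _ _ hF.left) (hc _ _ hs₁).symm (hc _ _ hs₂).symm
    (fun v => by rw [hx v]; tauto) hy
  have hex : ∀ j B, IsConn c d O (σ 1) s j B → excess Γ (B.erase s) ≤ 1 := by
    intro j B hB
    have hn : ∀ u ∈ B.erase s, u ≠ c 1 ∧ u ≠ s ∧ u ∉ ringSet c := fun u hu => by
      obtain ⟨h2, h3⟩ := Finset.mem_erase.1 hu
      have := Finset.disjoint_left.1 hB.disj' h3
      exact ⟨fun he => this (he ▸ IsRing.mem_c 1), h2, this⟩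
    refine le_trans (le_of_eq (excess_congr fun u hu v hv => ?_)) hB.excess_erase_le
    rw [← hag u v (hn u hu).1 (hn u hu).2.1 (hn v hv).1 (hn v hv).2.1,
      h.off _ _ (hn u hu).2.2 (hn v hv).2.2]
  have hst : ∀ i, i ≠ 1 → Γ.Adj (c i) (d (σ i)) := by
    intro i hi
    rw [← hag _ _ (hR.inj.ne hi) (hc _ _ hF.left) (hcd _ _).symm (hs _).symm,
      h.stub _ _ (hR.notMem _)]
  have hcB : ∀ j B i, IsConn c d O (σ 1) s j B → c i ∉ B.erase s := fun j B i hB hi =>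
    Finset.disjoint_left.1 hB.disj' (Finset.mem_of_mem_erase hi) (IsRing.mem_c i)
  have hcard : ∀ j B, IsConn c d O (σ 1) s j B → (B.erase s).card + 2 < m + 5 := fun j B hB => by
    have := Finset.card_erase_of_mem hB.left
    have := hB.card
    have := Finset.card_pos.2 ⟨s, hB.left⟩
    omega
  have hss₁ : s₁ ≠ s := fun he => O.loopless.irrefl s ((hadj s).2 (by simp [he]))
  rcases hh with ⟨hx', -⟩ | ⟨-, hy'⟩
  · exact hR.fam.false_of_insert_insert hΓ (hex _ _ hB) (hcard _ _ hB) (x := c 1) (y := c 0)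
      (u := s₁) (v := d (σ 0)) (hcB _ _ _ hB) (hcB _ _ _ hB) (by rw [hx']; tauto)
      (Finset.mem_erase.2 ⟨hss₁, h1⟩) (Finset.mem_erase.2 ⟨(hs _).symm, hB.right⟩)
      (by rw [hx']; tauto) (hst _ fin_zero_ne_one)
  · exact hR.fam.false_of_insert_insert hΓ (hex _ _ hB') (hcard _ _ hB') (x := s) (y := c 2)
      (u := s₁) (v := d (σ 2)) (by simp) (hcB _ _ _ hB') (by rw [hy']; tauto)
      (Finset.mem_erase.2 ⟨hss₁, h1'⟩) (Finset.mem_erase.2 ⟨(hs _).symm, hB'.right⟩)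
      (by rw [hy']; tauto) (hst _ fin_one_ne_two.symm)

lemma IsFork.false_of_three_isConn (hR : IsRing K c d O) (hF : IsFork c d O o s t)
    {B₁ B₂ B₃ : Finset V} (hj : j ≠ o) (hk : k ≠ o) (hl : l ≠ o) (hjk : j ≠ k) (hjl : j ≠ l)
    (hkl : k ≠ l) (h1 : IsConn c d O o s j B₁) (h2 : IsConn c d O o s k B₂)
    (h3 : IsConn c d O o s l B₃) : False := by
  have hs := h1.ne_stub hR h2 hjk
  obtain ⟨s₁, s₂, hn, hs₁, hs₂, hadj⟩ := hF.exists_adj hR hs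
  have hn' : [d o, s₂, s₁].Nodup := by
    simp only [List.nodup_cons, List.mem_cons, List.not_mem_nil, not_or, or_false] at hn ⊢
    exact ⟨⟨hn.1.2, hn.1.1⟩, Ne.symm hn.2.1, hn.2.2⟩
  have hadj' : ∀ v, O.Adj s v ↔ v = d o ∨ v = s₂ ∨ v = s₁ := fun v => by rw [hadj v]; tauto
  have key : ∀ j B, IsConn c d O o s j B → s₁ ∈ B ∨ s₂ ∈ B := by
    intro j B hB
    obtain ⟨u, hu, hsu⟩ := hB.exists_adj hR (hs j)
    rcases (hadj u).1 hsu with rfl | rfl | rfl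
    · exact absurd hu hB.notMem
    · exact Or.inl hu
    · exact Or.inr hu
  have g12 := hF.false_of_two_isConn hR hj hk hjk h1 h2 hn hs₁ hs₂ hadj
  have g13 := hF.false_of_two_isConn hR hj hl hjl h1 h3 hn hs₁ hs₂ hadj
  have g23 := hF.false_of_two_isConn hR hk hl hkl h2 h3 hn hs₁ hs₂ hadj
  have g12' := hF.false_of_two_isConn hR hj hk hjk h1 h2 hn' hs₂ hs₁ hadj'
  have g13' := hF.false_of_two_isConn hR hj hl hjl h1 h3 hn' hs₂ hs₁ hadj'
  have g23' := hF.false_of_two_isConn hR hk hl hkl h2 h3 hn' hs₂ hs₁ hadj'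
  rcases key _ _ h1 with m1 | m1 <;> rcases key _ _ h2 with m2 | m2 <;>
    rcases key _ _ h3 with m3 | m3 <;>
    first
    | exact g12 m1 m2 | exact g13 m1 m3 | exact g23 m2 m3
    | exact g12' m1 m2 | exact g13' m1 m3 | exact g23' m2 m3

/-- The combinatorial contradiction between the two ways of inserting a stub into the cycle. -/
lemma false_of_orientations {α : Type*} {S T : α → Prop} {P Q : α → α → Prop}
    (hPQ : ∀ j k, j ≠ k → P j k ∨ Q j k) (hP : ∀ j k, P j k → S j ∨ T k)
    (hQ : ∀ j k, Q j k → T j ∨ S k)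
    (hS : ∀ j k l, j ≠ k → j ≠ l → k ≠ l → S j → S k → S l → False)
    (hT : ∀ j k l, j ≠ k → j ≠ l → k ≠ l → T j → T k → T l → False)
    (hPT : ∀ j k l, P j k → P j l → T k → T l) (hQT : ∀ j k l, Q j l → Q k l → T j → T k)
    {p q r u : α} (hd : [p, q, r, u].Nodup) : False := by
  have core : ∀ j k l l', j ≠ k → j ≠ l → j ≠ l' → k ≠ l → k ≠ l' → l ≠ l' → S j → ¬ T j →
      T k → ¬ S k → False := by
    intro j k l l' n1 n2 n3 n4 n5 n6 hSj hTj hTk hSk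
    have hjk : P j k := (hPQ j k n1).resolve_right fun h => (hQ j k h).elim hTj hSk
    have hST : ∀ l, j ≠ l → S l ∨ T l := fun l hl => by
      rcases hPQ j l hl with h | h
      · exact Or.inr (hPT j k l hjk h hTk)
      · exact Or.inl ((hQ j l h).resolve_left hTj)
    have fin : ∀ l, j ≠ l → k ≠ l → S l → ¬ T l → False := by
      intro l hjl hkl hSl hTl
      have h1 : Q j l := (hPQ j l hjl).resolve_left fun h => hTl (hPT j k l hjk h hTk)
      have h2 : Q k l := (hPQ k l hkl).resolve_left fun h => (hP k l h).elim hSk hTl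
      exact hTj (hQT k j l h2 h1 hTk)
    have hSS := hS j l l' n2 n3 n6 hSj
    have hTT := hT k l l' n4 n5 n6 hTk
    have f1 := fin l n2 n4
    have f2 := fin l' n3 n5
    have g1 := hST l n2
    have g2 := hST l' n3
    tauto
  have out : ∀ j k, j ≠ k → S j ∨ T j ∨ S k ∨ T k := by
    intro j k h
    rcases hPQ j k h with h | h
    · have := hP j k h; tauto
    · have := hQ j k h; tauto
  simp only [List.nodup_cons, List.mem_cons, List.not_mem_nil, not_or, or_false] at hd
  obtain ⟨⟨n1, n2, n3⟩, ⟨n4, n5⟩, n6, -⟩ := hd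
  have o1 := out p q n1
  have o2 := out p r n2
  have o3 := out p u n3
  have o4 := out q r n4
  have o5 := out q u n5
  have o6 := out r u n6
  have s7 := hS p q r n1 n2 n4
  have t7 := hT p q r n1 n2 n4
  have s8 := hS p q u n1 n3 n5
  have t8 := hT p q u n1 n3 n5
  have s9 := hS p r u n2 n3 n6
  have t9 := hT p r u n2 n3 n6
  have s10 := hS q r u n4 n5 n6
  have t10 := hT q r u n4 n5 n6
  have c11 := core p q r u n1 n2 n3 n4 n5 n6
  have c12 := core p r q u n2 n1 n3 (Ne.symm n4) n6 n5
  have c13 := core p u q r n3 n1 n2 (Ne.symm n5) (Ne.symm n6) n4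
  have c14 := core q p r u (Ne.symm n1) n4 n5 n2 n3 n6
  have c15 := core q r p u n4 (Ne.symm n1) n5 (Ne.symm n2) n6 n3
  have c16 := core q u p r n5 (Ne.symm n1) n4 (Ne.symm n3) (Ne.symm n6) n2
  have c17 := core r p q u (Ne.symm n2) (Ne.symm n4) n6 n1 n3 n5
  have c18 := core r q p u (Ne.symm n4) (Ne.symm n2) n6 (Ne.symm n1) n5 n3
  have c19 := core r u p q n6 (Ne.symm n2) (Ne.symm n4) (Ne.symm n3) (Ne.symm n5) n1
  have c20 := core u p q r (Ne.symm n3) (Ne.symm n5) (Ne.symm n6) n1 n2 n4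
  have c21 := core u q p r (Ne.symm n5) (Ne.symm n3) (Ne.symm n6) (Ne.symm n1) n4 n2
  have c22 := core u r p q (Ne.symm n6) (Ne.symm n3) (Ne.symm n5) (Ne.symm n2) (Ne.symm n4) n1
  clear hPQ hP hQ hS hT hPT hQT core out n1 n2 n3 n4 n5 n6
  grind

end Elimination

section Contradiction

variable {V : Type*} [Fintype V] [DecidableEq V] {m : ℕ}
  {K : SimpleGraph V → Prop} {c d : Fin (m + 5) → V} {O : SimpleGraph V}

theorem IsRing.false (hR : IsRing K c d O) : False := by
  obtain ⟨s, t, hF⟩ := hR.exists_isFork 0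
  let A := {j : Fin (m + 5) // j ≠ 0}
  let P : V → V → A → A → Prop := fun s t j k =>
    ∃ σ Γ₀ Γ, σ 0 = j.1 ∧ σ 1 = 0 ∧ σ 2 = k.1 ∧ IsSpur K c d O σ Γ₀ s t Γ
  let S : V → A → Prop := fun s j => ∃ B, IsConn c d O 0 s j.1 B
  have hS : ∀ s t, IsFork c d O 0 s t → ∀ j k l : A, j ≠ k → j ≠ l → k ≠ l →
      S s j → S s k → S s l → False := by
    rintro s t hF j k l hjk hjl hkl ⟨B₁, h1⟩ ⟨B₂, h2⟩ ⟨B₃, h3⟩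
    exact hF.false_of_three_isConn hR j.2 k.2 l.2 (fun h => hjk (Subtype.ext h))
      (fun h => hjl (Subtype.ext h)) (fun h => hkl (Subtype.ext h)) h1 h2 h3
  have hP : ∀ s t j k, P s t j k → S s j ∨ S t k := by
    rintro s t j k ⟨σ, Γ₀, Γ, h0, h1, h2, h⟩
    have := h.exists_isConn hR
    rwa [h0, h1, h2] at this
  let f : Fin 4 → A := fun i =>
    ⟨⟨i.1 + 1, by omega⟩, fun h => absurd (congrArg Fin.val h) (Nat.succ_ne_zero _)⟩
  have hf : Function.Injective f := fun i k h =>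
    Fin.ext (Nat.succ_injective (congrArg (fun a : A => a.1.1) h))
  refine false_of_orientations (S := S s) (T := S t) (P := P s t) (Q := P t s) ?_ (hP s t) (hP t s)
    (hS s t hF) (hS t s hF.symm) ?_ ?_ (p := f 0) (q := f 1) (r := f 2)
    (u := f 3) ?_
  · intro j k hjk
    obtain ⟨σ, Γ₀, h, h0, h1, h2⟩ :=
      hR.exists_isState_three j.2 k.2.symm (fun h => hjk (Subtype.ext h))
    obtain ⟨Γ, hΓ | hΓ⟩ := h.exists_isSpur hR (h1 ▸ hF)
    · exact Or.inl ⟨σ, Γ₀, Γ, h0, h1, h2, hΓ⟩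
    · exact Or.inr ⟨σ, Γ₀, Γ, h0, h1, h2, hΓ⟩
  · rintro j k l ⟨σ, Γ₀, Γ, h0, h1, h2, h⟩ ⟨σ', Γ₀', Γ', h0', h1', h2', h'⟩ ⟨B, hB⟩
    replace hB : IsConn c d O (σ 1) t (σ 2) B := by rw [h1, h2]; exact hB
    have := h.exists_isConn_right hR h' (h1.trans h1'.symm) (h0.trans h0'.symm) hB
    rwa [h1', h2'] at this
  · rintro j k l ⟨σ, Γ₀, Γ, h0, h1, h2, h⟩ ⟨σ', Γ₀', Γ', h0', h1', h2', h'⟩ ⟨B, hB⟩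
    replace hB : IsConn c d O (σ 1) t (σ 0) B := by rw [h1, h0]; exact hB
    have := h.exists_isConn_left hR h' (h1.trans h1'.symm) (h2.trans h2'.symm) hB
    rwa [h1', h0'] at this
  · exact List.Nodup.map hf (l := [0, 1, 2, 3]) (by decide)

end Contradiction

section Deck

variable {V W : Type*} [Fintype V] [Fintype W] [DecidableEq V] [DecidableEq W]
  {G : SimpleGraph V} {H : SimpleGraph W} {k n : ℕ}

lemma degIn_map (f : G ↪g H) (S : Finset V) (v : V) :
    degIn H (S.map f.toEmbedding) (f v) = degIn G S v := by
  classical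
  unfold degIn
  rw [Finset.filter_map, Finset.card_map]
  congr 1
  ext u
  simp [f.map_adj_iff]

lemma isCore_map (f : G ↪g H) {S : Finset V} : IsCore H (S.map f.toEmbedding) ↔ IsCore G S := by
  unfold IsCore
  rw [Finset.map_nonempty]
  refine and_congr_right fun _ => ⟨fun h v hv => ?_, fun h v hv => ?_⟩
  · rw [← degIn_map f]
    exact h _ (Finset.mem_map_of_mem f.toEmbedding hv)
  · obtain ⟨u, hu, rfl⟩ := Finset.mem_map.1 hv
    exact (h u hu).trans_eq (degIn_map f S u).symm

lemma isTight_map (f : G ↪g H) {S : Finset V} :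
    IsTight H k (S.map f.toEmbedding) ↔ IsTight G k S := by
  unfold IsTight
  rw [isCore_map, Finset.card_map]

lemma ncard_isTight_of_embedding (f : G ↪g H) :
    {S | IsTight G k S}.ncard = {S : Finset W | (S : Set W) ⊆ Set.range f ∧ IsTight H k S}.ncard := by
  rw [← Set.ncard_image_of_injective _ (Finset.map_injective f.toEmbedding)]
  congr 1
  ext S
  simp only [Set.mem_image, Set.mem_ofPred_eq]
  constructor
  · rintro ⟨T, hT, rfl⟩
    refine ⟨?_, (isTight_map f).2 hT⟩
    rw [Finset.coe_map]
    exact Set.image_subset_range _ _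
  · rintro ⟨hS, hT⟩
    obtain ⟨T, rfl⟩ : ∃ T : Finset V, T.map f.toEmbedding = S := by
      refine ⟨Finset.univ.filter (f · ∈ S), ?_⟩
      ext w
      simp only [Finset.mem_map, Finset.mem_filter, Finset.mem_univ, true_and]
      refine ⟨?_, fun hw => ?_⟩
      · rintro ⟨v, hv, rfl⟩; exact hv
      · obtain ⟨v, rfl⟩ := hS hw
        exact ⟨v, hw, rfl⟩
    exact ⟨T, (isTight_map f).1 hT, rfl⟩

lemma ncard_isTight_of_iso (f : G ≃g H) :
    {S | IsTight G k S}.ncard = {S | IsTight H k S}.ncard := by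
  rw [ncard_isTight_of_embedding f.toEmbedding]
  congr 1
  ext S
  simp only [Set.mem_ofPred_eq, and_iff_right_iff_imp]
  intro _ w _
  exact f.surjective w

lemma card_powersetCard_superset (S : Finset V) :
    ((Finset.univ.powersetCard n).filter (S ⊆ ·)).card =
      if S.card ≤ n then (Fintype.card V - S.card).choose (n - S.card) else 0 := by
  split_ifs with h
  · rw [← Finset.card_compl, ← Finset.card_powersetCard]
    refine Finset.card_nbij' (· \ S) (· ∪ S) ?_ ?_ ?_ ?_
    · intro T hT
      simp only [Finset.coe_filter, Finset.mem_powersetCard, Finset.subset_univ, true_and,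
        Set.mem_ofPred_eq, Finset.mem_coe] at hT ⊢
      exact ⟨fun v hv => by simp at hv ⊢; exact hv.2, by rw [Finset.card_sdiff_of_subset hT.2, hT.1]⟩
    · intro T hT
      simp only [Finset.coe_filter, Finset.mem_powersetCard, Finset.subset_univ, true_and,
        Set.mem_ofPred_eq, Finset.mem_coe] at hT ⊢
      have hd : Disjoint T S := Finset.subset_compl_iff_disjoint_right.1 hT.1
      exact ⟨by rw [Finset.card_union_of_disjoint hd, hT.2]; omega, Finset.subset_union_right⟩
    · intro T hT
      simp only [Finset.coe_filter, Set.mem_ofPred_eq] at hT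
      exact Finset.sdiff_union_of_subset hT.2
    · intro T hT
      simp only [Finset.mem_powersetCard, Finset.mem_coe] at hT
      exact Finset.union_sdiff_cancel_right (Finset.subset_compl_iff_disjoint_right.1 hT.1)
  · rw [Finset.card_eq_zero, Finset.filter_eq_empty_iff]
    intro T hT hS
    have := Finset.card_le_card hS
    rw [Finset.mem_powersetCard] at hT
    omega

lemma sum_ncard_isTight_induce (G : SimpleGraph V) (hk : k ≤ n) :
    ∑ T : {T : Finset V // T.card = n}, {S | IsTight (G.induce (↑T.1 : Set V)) k S}.ncard =
      {S | IsTight G k S}.ncard * (Fintype.card V - k).choose (n - k) := by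
  classical
  have h1 : ∀ T : Finset V, {S | IsTight (G.induce (↑T : Set V)) k S}.ncard =
      ((Finset.univ.filter (IsTight G k)).filter (· ⊆ T)).card := by
    intro T
    rw [ncard_isTight_of_embedding (Embedding.induce (G := G) (↑T : Set V)),
      ← Set.ncard_coe_finset]
    congr 1
    ext S
    simp [and_comm, Set.subset_def, Finset.subset_iff]
  have h2 : {S | IsTight G k S}.ncard = (Finset.univ.filter (IsTight G k)).card := by
    rw [← Set.ncard_coe_finset]
    simp
  simp_rw [h1]
  rw [h2, ← Finset.sum_subtype (Finset.univ.powersetCard n) (by simp)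
    (fun T => ((Finset.univ.filter (IsTight G k)).filter (· ⊆ T)).card)]
  have h3 := Finset.sum_card_bipartiteAbove_eq_sum_card_bipartiteBelow
    (s := Finset.univ.filter (IsTight G k)) (t := (Finset.univ : Finset V).powersetCard n)
    (r := fun S T => S ⊆ T)
  unfold Finset.bipartiteAbove Finset.bipartiteBelow at h3
  rw [← h3, ← smul_eq_mul, ← Finset.sum_const]
  refine Finset.sum_congr rfl fun S hS => ?_
  have hc : S.card = k := (Finset.mem_filter.1 hS).2.1
  rw [card_powersetCard_superset, if_pos (by omega), hc]

lemma SameDeck.ncard_isTight (h : SameDeck G H n) (hcard : Fintype.card V = Fintype.card W)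
    (hn : n ≤ Fintype.card V) (hk : k ≤ n) :
    {S | IsTight G k S}.ncard = {S | IsTight H k S}.ncard := by
  obtain ⟨e, he⟩ := h
  have h1 := sum_ncard_isTight_induce G hk
  have h2 := sum_ncard_isTight_induce H hk
  rw [← e.sum_comp, ← Finset.sum_congr rfl fun T _ => ncard_isTight_of_iso (he T).some, h1,
    ← hcard] at h2
  exact Nat.eq_of_mul_eq_mul_right (Nat.choose_pos (by omega)) h2

lemma SameDeck.symm (h : SameDeck G H n) : SameDeck H G n := by
  obtain ⟨e, he⟩ := h
  refine ⟨e.symm, fun s => ?_⟩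
  have := he (e.symm s)
  rw [e.apply_symm_apply] at this
  exact ⟨this.some.symm⟩

lemma SameDeck.exists_equiv (h : SameDeck G H (Fintype.card V - 2))
    (hcard : Fintype.card V = Fintype.card W) {x y : V} (hxy : x ≠ y) :
    ∃ e : V ≃ W, ∀ u v, u ≠ x → u ≠ y → v ≠ x → v ≠ y → (G.Adj u v ↔ H.Adj (e u) (e v)) := by
  obtain ⟨e, he⟩ := h
  let s : {s : Finset V // s.card = Fintype.card V - 2} :=
    ⟨{x, y}ᶜ, by rw [Finset.card_compl, Finset.card_pair hxy]⟩
  obtain ⟨φ⟩ := he s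
  let e₀ := Fintype.equivOfCardEq hcard
  let f : V → W := fun v => if hv : v ∈ s.1 then φ ⟨v, hv⟩ else e₀ v
  have hf : ∀ v (hv : v ∈ s.1), f v = φ ⟨v, hv⟩ := fun v hv => dif_pos hv
  obtain ⟨ψ, hψ⟩ := Finset.exists_equiv_extend_of_card_eq (t := (Finset.univ : Finset W))
    (by rw [hcard, Finset.card_univ]) (s := s.1) (f := f) (Finset.subset_univ _) (by
      intro u hu v hv huv
      rw [hf u hu, hf v hv] at huv
      simpa using φ.injective (Subtype.ext huv))
  have hs : ∀ v, v ≠ x → v ≠ y → v ∈ s.1 := fun v hx hy => by simp [s, hx, hy]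
  refine ⟨ψ.trans (Equiv.subtypeUnivEquiv Finset.mem_univ), fun u v h1 h2 h3 h4 => ?_⟩
  have hu := hs u h1 h2
  have hv := hs v h3 h4
  have := φ.map_adj_iff (v := ⟨u, hu⟩) (w := ⟨v, hv⟩)
  simp only [comap_adj, Function.Embedding.subtype_apply, Equiv.trans_apply] at this ⊢
  rw [← this]
  simp only [Equiv.subtypeUnivEquiv_apply, hψ u hu, hψ v hv, hf u hu, hf v hv]

end Deck

section Girth

variable {V W : Type*} [Fintype V] [Fintype W] [DecidableEq V] [DecidableEq W]
  {K : SimpleGraph V → Prop} {G Γ : SimpleGraph V} {H : SimpleGraph W} {g k m n : ℕ}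
  {S : Finset V} {v x y z w : V}

lemma degIn_univ [DecidableRel G.Adj] (v : V) : degIn G Finset.univ v = G.degree v := by
  classical
  rw [← card_neighborFinset_eq_degree, neighborFinset_eq_filter]
  unfold degIn
  congr!

lemma exists_adj_iff (h : degIn Γ Finset.univ x = 3) (hz : Γ.Adj x z) (hw : Γ.Adj x w)
    (hzw : z ≠ w) : ∃ a, a ≠ z ∧ a ≠ w ∧ ∀ v, Γ.Adj x v ↔ v = z ∨ v = w ∨ v = a := by
  classical
  unfold degIn at h
  rw [← Finset.card_erase_add_one (a := z) (by simpa using hz),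
    ← Finset.card_erase_add_one (a := w) (by simpa using ⟨hzw.symm, hw⟩)] at h
  obtain ⟨a, ha⟩ := Finset.card_eq_one.1 (by omega :
    (((Finset.univ.filter (Γ.Adj x)).erase z).erase w).card = 1)
  have h1 : ∀ v, v ≠ w ∧ v ≠ z ∧ Γ.Adj x v ↔ v = a := fun v => by
    simpa using Finset.ext_iff.1 ha v
  have h2 := (h1 a).2 rfl
  refine ⟨a, h2.2.1, h2.1, fun v => ?_⟩
  have h3 := h1 v
  by_cases e1 : v = z
  · subst e1; simpa using hz
  by_cases e2 : v = w
  · subst e2; simpa using hw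
  simpa [e1, e2] using h3

lemma IsCore.egirth_le (h : IsCore Γ S) : Γ.egirth ≤ S.card := by
  classical
  let D := Γ.induce (S : Set V)
  have hdeg : ∀ v : (S : Set V), 2 ≤ degIn D Finset.univ v := by
    intro v
    rw [← degIn_map (Embedding.induce (G := Γ) (S : Set V))]
    refine (h.2 v.1 v.2).trans_eq ?_
    congr 1
    ext u
    simp
  have hcyc : ¬ D.IsAcyclic := by
    intro hac
    obtain ⟨v₀, hv₀⟩ := h.1
    have : Nonempty (S : Set V) := ⟨⟨v₀, hv₀⟩⟩
    obtain ⟨u, v, p, hp, hmax⟩ := Walk.exists_isPath_forall_isPath_length_le_length D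
    have hu := hdeg u
    obtain ⟨a, ha, b, hb, hab⟩ := Finset.one_lt_card.1 hu
    simp only [Finset.mem_filter, Finset.mem_univ, true_and] at ha hb
    have key : ∀ a, D.Adj u a → a = p.snd := by
      intro a ha
      refine hac.eq_snd_of_adj_start hp ha ?_
      by_contra hn
      have := hmax a v (Walk.cons ha.symm p) ((Walk.cons_isPath_iff _ _).2 ⟨hp, hn⟩)
      simp at this
    exact hab ((key a ha).trans (key b hb).symm)
  unfold IsAcyclic at hcyc
  push Not at hcyc
  obtain ⟨v, c, hc⟩ := hcyc
  have h1 := egirth_le_length (hc.map (f := (Embedding.induce (G := Γ) (S : Set V)).toHom)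
    (Embedding.induce (G := Γ) (S : Set V)).injective)
  have h2 := hc.support_nodup.length_le_card
  refine h1.trans ?_
  rw [Walk.length_map]
  simpa using h2

lemma two_lt_card_of_egirth (hreg : ∀ v, degIn Γ Finset.univ v = 3) (hg : Γ.egirth = g)
    (h5 : 5 ≤ g) (hn : g ≤ Fintype.card V) (hxy : Γ.Adj x y) : g ≤ Fintype.card V - 2 := by
  by_contra hlt
  have h1 := two_mul_excess Γ Finset.univ
  simp_rw [hreg] at h1
  have h2 := excess_erase (Γ := Γ) (Finset.mem_univ x)
  have hy : y ∈ Finset.univ.erase x := by simp [hxy.ne']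
  have h3 := excess_erase (Γ := Γ) hy
  have h4 := degIn_insert (Γ := Γ) (u := y) (Finset.notMem_erase x Finset.univ)
  have hc1 := Finset.card_erase_of_mem (Finset.mem_univ x)
  have hc2 := Finset.card_erase_of_mem hy
  rw [Finset.insert_erase (Finset.mem_univ x), hreg, if_pos hxy.symm] at h4
  rw [hreg] at h2
  simp only [Finset.sum_const, smul_eq_mul, Finset.card_univ] at h1 hc1
  obtain ⟨T, hT, hT'⟩ := exists_isCore_of_excess_nonpos (Γ := Γ)
    (S := (Finset.univ.erase x).erase y) (Finset.card_pos.1 (by omega)) (by omega)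
  have h6 := hT'.egirth_le
  have h7 := Finset.card_le_card hT
  rw [hg, Nat.cast_le] at h6
  omega

lemma IsGirthFamily.exists_isRing (hK : IsGirthFamily K (m + 5)) (hΓ : K Γ)
    {c : Fin (m + 5) → V} (hc : Function.Injective c) (hadj : ∀ i, Γ.Adj (c i) (c (i + 1))) :
    ∃ d, IsRing K c d Γ := by
  classical
  have hadj' : ∀ i, Γ.Adj (c i) (c (i - 1)) := fun i => by
    have := (hadj (i - 1)).symm
    rwa [sub_add_cancel] at this
  have hne : ∀ i, c (i + 1) ≠ c (i - 1) := fun i h => by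
    have h2 := hc h
    rw [eq_sub_iff_add_eq, add_assoc, fin_one_add_one, add_eq_left] at h2
    exact fin_zero_ne_two h2.symm
  have hm : ∀ i, c i ∈ ringSet c := fun i => IsRing.mem_c i
  have ht : IsTight Γ (m + 5) (ringSet c) := by
    refine ⟨by rw [ringSet, Finset.card_image_of_injective _ hc]; simp, ⟨c 0, hm 0⟩, ?_⟩
    intro v hv
    obtain ⟨i, rfl⟩ := mem_ringSet.1 hv
    exact two_le_degIn (hm _) (hm _) (hne i) (hadj i) (hadj' i)
  choose d hd1 hd2 hd using fun i =>
    exists_adj_iff (hK.reg Γ hΓ (c i)) (hadj i) (hadj' i) (hne i)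
  have hnot : ∀ i, d i ∉ ringSet c := fun i hi => by
    have h2 := hK.degIn_eq_two hΓ ht (hm i)
    have h3 : ({c (i + 1), c (i - 1), d i} : Finset V) ⊆ (ringSet c).filter (Γ.Adj (c i)) := by
      intro v
      simp only [Finset.mem_insert, Finset.mem_singleton, Finset.mem_filter, hd]
      rintro (rfl | rfl | rfl) <;> simp [hm, hi]
    have h4 := Finset.card_le_card h3
    rw [Finset.card_eq_three.2 ⟨_, _, _, hne i, (hd1 i).symm, (hd2 i).symm, rfl⟩] at h4
    unfold degIn at h2
    omega
  refine ⟨d, hK, hc, hnot, hΓ, fun i j => ?_, fun u v _ _ => Iff.rfl, fun i v hv => ?_⟩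
  · have : c j ≠ d i := fun h => hnot i (h ▸ hm j)
    simp only [hd, hc.eq_iff, this, or_false, eq_sub_iff_add_eq, eq_comm (a := i)]
  · have h1 : v ≠ c (i + 1) := fun h => hv (h ▸ hm _)
    have h2 : v ≠ c (i - 1) := fun h => hv (h ▸ hm _)
    simp [hd, h1, h2]

lemma IsAltFamily.not_triangle (hK : IsAltFamily K) (hΓ : K Γ) (hxy : Γ.Adj x y)
    (hxw : Γ.Adj x w) (hyw : Γ.Adj y w) : False := by
  obtain ⟨a, h1, h2, ha⟩ := exists_adj_iff (hK.reg Γ hΓ x) hxy hxw hyw.ne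
  obtain ⟨b, h3, h4, hb⟩ := exists_adj_iff (hK.reg Γ hΓ y) hxy.symm hyw hxw.ne
  have h5 : b ≠ y := fun h => ((hb b).2 (by simp)).ne h.symm
  exact hK.false_of_two_links hΓ hxy.ne (Or.inl ⟨rfl, rfl⟩) hxw.ne' hyw.ne' hyw.ne' h1 h2 h1 h5 h4
    h3 ha hb

lemma IsAltFamily.not_square (hK : IsAltFamily K) (hΓ : K Γ) (hxy : x ≠ y) (hzw : z ≠ w)
    (hxz : Γ.Adj x z) (hxw : Γ.Adj x w) (hyz : Γ.Adj y z) (hyw : Γ.Adj y w) : False := by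
  obtain ⟨a, h1, h2, ha⟩ := exists_adj_iff (hK.reg Γ hΓ x) hxz hxw hzw
  obtain ⟨b, h3, h4, hb⟩ := exists_adj_iff (hK.reg Γ hΓ y) hyz hyw hzw
  have h5 : ¬ Γ.Adj x y := fun h => hK.not_triangle hΓ h hxz hyz
  refine hK.false_of_two_links hΓ hxy (Or.inr ⟨rfl, hxz.ne', hyz.ne'⟩) hxw.ne' hyw.ne' hzw.symm
    h1 h2 ?_ h3 h4 ?_ ha hb
  · rintro rfl
    exact h5 ((ha a).2 (by simp))
  · rintro rfl
    exact h5 ((hb b).2 (by simp)).symm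

end Girth

section DeckFamily

variable {V W : Type*} [Fintype V] [Fintype W] [DecidableEq V] [DecidableEq W]
  {G Γ : SimpleGraph V} {H : SimpleGraph W} {g n : ℕ}

lemma degIn_univ_of_iso (f : G ≃g H) (v : V) :
    degIn G Finset.univ v = degIn H Finset.univ (f v) := by
  rw [← degIn_map f.toEmbedding]
  congr 1
  ext w
  simp

lemma SameDeck.exists_iso_agreeOff {V₁ V₂ : Type*} [Fintype V₁] [Fintype V₂] [DecidableEq V₁]
    [DecidableEq V₂] {G₁ : SimpleGraph V₁} {G₂ : SimpleGraph V₂}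
    (h : SameDeck G₁ G₂ (Fintype.card V₁ - 2)) (hcard : Fintype.card V₁ = Fintype.card V₂)
    (hniso : ¬ Nonempty (G₁ ≃g G₂)) (f : Γ ≃g G₁) {x y : V} (hxy : x ≠ y) :
    ∃ Γ' : SimpleGraph V, Nonempty (Γ' ≃g G₂) ∧ AgreeOff Γ Γ' x y ∧
      ∀ e : Equiv.Perm V, Γ' ≠ Γ.comap e := by
  obtain ⟨e, he⟩ := h.exists_equiv hcard (f.injective.ne hxy)
  refine ⟨G₂.comap (f.toEquiv.trans e), ⟨Iso.comap (f.toEquiv.trans e) G₂⟩,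
    fun u v h1 h2 h3 h4 => ?_, fun e' he' => hniso ⟨?_⟩⟩
  · rw [← f.map_adj_iff]
    exact he _ _ (f.injective.ne h1) (f.injective.ne h2) (f.injective.ne h3) (f.injective.ne h4)
  · refine f.symm.trans ((Iso.comap e' Γ).symm.trans ?_)
    rw [← he']
    exact Iso.comap (f.toEquiv.trans e) G₂

/-- The graphs on `V` isomorphic to `G` or to `H`. -/
def DeckFamily (G : SimpleGraph V) (H : SimpleGraph W) (Γ : SimpleGraph V) : Prop :=
  Nonempty (Γ ≃g G) ∨ Nonempty (Γ ≃g H)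

lemma deckFamily_self : DeckFamily G H G := Or.inl ⟨Iso.refl⟩

lemma SameDeck.isAltFamily (h : SameDeck G H (Fintype.card V - 2))
    (hcard : Fintype.card V = Fintype.card W) (hniso : ¬ Nonempty (G ≃g H))
    (hG : ∀ v, degIn G Finset.univ v = 3) (hH : ∀ v, degIn H Finset.univ v = 3) :
    IsAltFamily (DeckFamily G H) where
  comap := by
    rintro Γ (⟨⟨f⟩⟩ | ⟨⟨f⟩⟩) e
    · exact Or.inl ⟨(Iso.comap e Γ).trans f⟩
    · exact Or.inr ⟨(Iso.comap e Γ).trans f⟩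
  reg := by
    rintro Γ (⟨⟨f⟩⟩ | ⟨⟨f⟩⟩) v
    · rw [degIn_univ_of_iso f, hG]
    · rw [degIn_univ_of_iso f, hH]
  alt := by
    rintro Γ (⟨⟨f⟩⟩ | ⟨⟨f⟩⟩) x y hxy
    · obtain ⟨Γ', h1, h2⟩ := h.exists_iso_agreeOff hcard hniso f hxy
      exact ⟨Γ', Or.inr h1, h2⟩
    · obtain ⟨Γ', h1, h2⟩ := (hcard ▸ h).symm.exists_iso_agreeOff hcard.symm
        (fun ⟨e⟩ => hniso ⟨e.symm⟩) f hxy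
      exact ⟨Γ', Or.inl h1, h2⟩

lemma SameDeck.isGirthFamily (h : SameDeck G H (Fintype.card V - 2))
    (hcard : Fintype.card V = Fintype.card W) (hK : IsAltFamily (DeckFamily G H))
    (hg : G.egirth = g) (hn : g ≤ Fintype.card V - 2) : IsGirthFamily (DeckFamily G H) g where
  toIsAltFamily := hK
  three_le := by
    have := three_le_egirth (G := G)
    rw [hg] at this
    exact_mod_cast this
  girth := by
    have key : ∀ S, IsCore G S → g ≤ S.card := fun S hS => by
      have := hS.egirth_le
      rw [hg] at this
      exact_mod_cast this
    rintro Γ hΓ S hS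
    by_contra hlt
    have h0 : {T | IsTight G S.card T}.ncard = {T | IsTight Γ S.card T}.ncard := by
      obtain ⟨⟨f⟩⟩ | ⟨⟨f⟩⟩ := hΓ
      · exact (ncard_isTight_of_iso f).symm
      · rw [ncard_isTight_of_iso f]
        exact h.ncard_isTight hcard (Nat.sub_le _ _) (by omega)
    rw [(Set.ncard_eq_zero (Set.toFinite _)).2] at h0
    · have := (Set.ncard_eq_zero (Set.toFinite _)).1 h0.symm
      exact Set.eq_empty_iff_forall_notMem.1 this S ⟨rfl, hS⟩
    · rw [Set.eq_empty_iff_forall_notMem]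
      rintro T ⟨h1, h2⟩
      have := key T h2
      omega
  count := by
    have key : ∀ Γ, DeckFamily G H Γ → {S | IsTight Γ g S}.ncard = {S | IsTight G g S}.ncard := by
      rintro Γ (⟨⟨f⟩⟩ | ⟨⟨f⟩⟩)
      · exact ncard_isTight_of_iso f
      · rw [ncard_isTight_of_iso f, h.ncard_isTight hcard (Nat.sub_le _ _) hn]
    intro Γ Γ' h1 h2
    rw [key Γ h1, key Γ' h2]

lemma exists_cycle_map {m : ℕ} {v : V} {C : G.Walk v v} (hC : C.IsCycle) (hl : C.length = m + 3) :
    ∃ c : Fin (m + 3) → V, Function.Injective c ∧ ∀ i, G.Adj (c i) (c (i + 1)) := by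
  refine ⟨fun i => C.getVert i, fun i j hij => Fin.ext ?_, fun i => ?_⟩
  · exact hC.getVert_injOn' (by simp; omega) (by simp; omega) hij
  · have h := C.adj_getVert_succ (i := i) (by omega)
    by_cases hi : i.1 + 1 < m + 3
    · have : (i + 1).1 = i.1 + 1 := Fin.val_add_one_of_lt' hi
      beta_reduce
      rwa [this]
    · have h1 : i.1 + 1 = m + 3 := by omega
      have : (i + 1).1 = 0 := by
        rw [Fin.val_add, Fin.val_one, h1, Nat.mod_self]
      rw [C.getVert_of_length_le (i := i + 1) (by omega)] at h
      beta_reduce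
      rwa [this, C.getVert_zero]

theorem SameDeck.false_of_egirth (h : SameDeck G H (Fintype.card V - 2))
    (hcard : Fintype.card V = Fintype.card W) (hniso : ¬ Nonempty (G ≃g H))
    (hG : ∀ v, degIn G Finset.univ v = 3) (hH : ∀ v, degIn H Finset.univ v = 3)
    (hg : G.egirth = g) : False := by
  have hK := h.isAltFamily hcard hniso hG hH
  obtain ⟨v, C, hC, hl⟩ := exists_egirth_eq_length.2 (fun hac => by
    rw [egirth_eq_top.2 hac] at hg
    exact ENat.top_ne_natCast g hg)
  rw [hg, Nat.cast_inj] at hl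
  have h3 := hC.three_le_length
  obtain ⟨m, hm⟩ := Nat.exists_eq_add_of_le' h3
  obtain ⟨c, hc, hadj⟩ := exists_cycle_map hC hm
  obtain rfl | rfl | ⟨m, rfl⟩ : m = 0 ∨ m = 1 ∨ ∃ k, m = k + 2 := by
    obtain _ | _ | m := m <;> simp
  · exact hK.not_triangle deckFamily_self (hadj 0) (hadj 2).symm (hadj 1)
  · exact hK.not_square deckFamily_self (x := c 0) (y := c 2) (z := c 1) (w := c 3)
      (hc.ne (by decide)) (hc.ne (by decide)) (hadj 0) (hadj 3).symm (hadj 1).symm (hadj 2)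
  · have hn := two_lt_card_of_egirth hG hg (by omega)
      (by simpa [hl, hm] using Fintype.card_le_of_injective c hc) (hadj 0)
    have hF := h.isGirthFamily hcard hK hg hn
    rw [hl, hm] at hF
    obtain ⟨d, hR⟩ := IsGirthFamily.exists_isRing (m := m) hF deckFamily_self hc hadj
    exact hR.false

end DeckFamily

/-- Standing hypotheses: `G` and `H` are 3-regular graphs on the same number `n` of vertices
with the same `(n-2)`-deck, `H` is not isomorphic to `G`, and `g` is the girth of `G`. -/
theorem no_vertex_in_g_cycle_and_two_g1_cycles
    {V W : Type*} [Fintype V] [Fintype W] [DecidableEq V] [DecidableEq W]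
    (G : SimpleGraph V) (H : SimpleGraph W)
    [DecidableRel G.Adj] [DecidableRel H.Adj]
    (hG : G.IsRegularOfDegree 3) (hH : H.IsRegularOfDegree 3)
    (hcard : Fintype.card V = Fintype.card W)
    (hdeck : SameDeck G H (Fintype.card V - 2))
    (hniso : ¬ Nonempty (G ≃g H))
    (g : ℕ) (hgirth : G.egirth = g)
    :
    ¬ ∃ (x : V) (v₀ v₁ v₂ : V) (C : G.Walk v₀ v₀) (Q : G.Walk v₁ v₁) (R : G.Walk v₂ v₂),
      C.IsCycle ∧ C.length = g ∧
      Q.IsCycle ∧ Q.length = g + 1 ∧ R.IsCycle ∧ R.length = g + 1 ∧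
      {e | e ∈ Q.edges} ≠ {e | e ∈ R.edges} ∧
      x ∈ C.support ∧ x ∈ Q.support ∧ x ∈ R.support := fun _ =>
  hdeck.false_of_egirth hcard hniso (fun v => (degIn_univ v).trans (hG v))
    (fun v => (degIn_univ v).trans (hH v)) hgirth
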